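/- Under the Cayley setup, the following Dehn–Sommerville-like equations hold for all 0 ≤ k ≤ d+1: h_{d+1−k}(F) = h_k(F) + g_k(∂P1) + g_k(∂P2). -/

import Mathlib

open Set Pointwise

noncomputable section

/-- Euclidean `d`-space `E^d`, modeled as `Fin d → ℝ`. -/
abbrev Euc (d : ℕ) : Type := Fin d → ℝ

/-- The (affine) dimension of a subset of Euclidean space: the dimension of its affine hull. -/
def setDim {d : ℕ} (F : Set (Euc d)) : ℕ :=
  Module.finrank ℝ (affineSpan ℝ F).direction

/-- A (convex) polytope: the convex hull of a finite point set. -/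
def IsPolytope {d : ℕ} (P : Set (Euc d)) : Prop :=
  ∃ S : Set (Euc d), S.Finite ∧ P = convexHull ℝ S

/-- `F` is a proper (nonempty) face of `P`: `F` is an exposed face of `P` (the intersection
of `P` with a supporting hyperplane) which is nonempty and different from `P` itself. -/
def IsProperFaceOf {d : ℕ} (P F : Set (Euc d)) : Prop :=
  IsExposed ℝ P F ∧ F ≠ P ∧ F.Nonempty

/-- The vertex set of a polytope: its set of extreme points. -/
def vertSet {d : ℕ} (P : Set (Euc d)) : Set (Euc d) :=
  Set.extremePoints ℝ P

/-- The number of vertices of a polytope. -/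
def vertCount {d : ℕ} (P : Set (Euc d)) : ℕ := (vertSet P).ncard

/-- `faceCount P k` is `f_k(P)`, the number of `k`-dimensional (proper) faces of `P`. -/
def faceCount {d : ℕ} (P : Set (Euc d)) (k : ℕ) : ℕ :=
  {F : Set (Euc d) | IsProperFaceOf P F ∧ setDim F = k}.ncard

/-- The moment curve `t ↦ (t, t², …, t^δ)` in `E^δ`. -/
def momentCurve (δ : ℕ) (t : ℝ) : Euc δ := fun i => t ^ ((i : ℕ) + 1)

/-- A standard realization of the cyclic `δ`-polytope `C_δ(n)` with `n` vertices:
the convex hull of `n` distinct points on the moment curve. -/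
def cyclicPolytope (δ n : ℕ) : Set (Euc δ) :=
  convexHull ℝ (momentCurve δ '' (Set.range fun j : Fin n => (j : ℝ) + 1))

/-- `S` is the vertex set of a proper face of `P` of dimension `|S| - 1`. -/
def IsSimplexFaceVertexSet {d : ℕ} (P S : Set (Euc d)) : Prop :=
  ∃ F : Set (Euc d), IsProperFaceOf P F ∧ vertSet F = S ∧ setDim F + 1 = S.ncard

/-- A polytope `P` is `(V1; k)`-bineighborly: `V1` is a nonempty proper subset of the vertex
set of `P`, and for all nonempty `S1 ⊆ V1` and `S2 ⊆ V ∖ V1` with `|S1| + |S2| ≤ k`,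
the set `S1 ∪ S2` is the vertex set of a face of `P` of dimension `|S1| + |S2| - 1`. -/
def PolytopeBineighborly {d : ℕ} (P V1 : Set (Euc d)) (k : ℕ) : Prop :=
  V1.Nonempty ∧ V1 ⊂ vertSet P ∧
    ∀ S1 S2 : Set (Euc d), S1.Nonempty → S2.Nonempty →
      S1 ⊆ V1 → S2 ⊆ vertSet P \ V1 → S1.ncard + S2.ncard ≤ k →
        IsSimplexFaceVertexSet P (S1 ∪ S2)

/-- A polytope is `k`-neighborly if every nonempty subset of at most `k` of its vertices is
the vertex set of a face. -/
def PolytopeNeighborly {d : ℕ} (P : Set (Euc d)) (k : ℕ) : Prop :=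
  ∀ S : Set (Euc d), S ⊆ vertSet P → S.Nonempty → S.ncard ≤ k →
    ∃ F : Set (Euc d), IsProperFaceOf P F ∧ vertSet F = S

/-- Embed `E^d` into the hyperplane `{x_{d+1} = c}` of `E^{d+1}`. -/
def lift {d : ℕ} (c : ℝ) (x : Euc d) : Euc (d + 1) := Fin.snoc x c

/-- The Cayley polytope `CH_{d+1}({P1, P2})` of `P1` embedded in `{x_{d+1} = 0}` and
`P2` embedded in `{x_{d+1} = 1}`. -/
def cayley {d : ℕ} (P1 P2 : Set (Euc d)) : Set (Euc (d + 1)) :=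
  convexHull ℝ (lift 0 '' P1 ∪ lift 1 '' P2)

/-- `ubTerm n d k = binom (n - d - 2 + k) k` (equal to the true binomial for `n ≥ d + 1`). -/
def ubTerm (n d k : ℕ) : ℕ := (n + k - (d + 2)).choose k

/-- The upper bound for `f_{k-1}(P1 ⊕ P2)`:
`f_k(C_{d+1}(n1+n2)) - ∑_{i=0}^{⌊(d+1)/2⌋} binom(d+1-i, k+1-i) (binom(n1-d-2+i, i) + binom(n2-d-2+i, i))`. -/
def minkBound (d n1 n2 k : ℕ) : ℤ :=
  (faceCount (cyclicPolytope (d + 1) (n1 + n2)) k : ℤ)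
    - ∑ i ∈ Finset.range ((d + 1) / 2 + 1),
        (if i ≤ k + 1 then ((d + 1 - i).choose (k + 1 - i) : ℤ) else 0)
          * ((ubTerm n1 d i : ℤ) + (ubTerm n2 d i : ℤ))

/-- A polytopal complex in `E^N`: a finite nonempty collection of polytopes containing `∅`,
closed under taking faces, such that pairwise intersections are faces of both. -/
structure PolyComplex (N : ℕ) where
  faces : Set (Set (Euc N))
  finite_faces : faces.Finite
  empty_mem : ∅ ∈ faces
  polytope_mem : ∀ F ∈ faces, IsPolytope F
  down_closed : ∀ F ∈ faces, ∀ G : Set (Euc N), IsExposed ℝ F G → G ∈ faces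
  inter_face : ∀ F ∈ faces, ∀ G ∈ faces, IsExposed ℝ F (F ∩ G) ∧ IsExposed ℝ G (F ∩ G)

namespace PolyComplex

/-- The vertex set of a complex: its `0`-dimensional faces. -/
def verts {N : ℕ} (C : PolyComplex N) : Set (Euc N) := {v : Euc N | {v} ∈ C.faces}

/-- `C` is a (pure-dimension-bounded) `d`-complex: all faces have dimension at most `d`
and some face has dimension exactly `d`. -/
def IsDComplex {N : ℕ} (C : PolyComplex N) (d : ℕ) : Prop :=
  (∀ F ∈ C.faces, setDim F ≤ d) ∧ ∃ F ∈ C.faces, setDim F = d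

/-- A complex `C` is `(V1; k)`-bineighborly. -/
def Bineighborly {N : ℕ} (C : PolyComplex N) (V1 : Set (Euc N)) (k : ℕ) : Prop :=
  V1.Nonempty ∧ V1 ⊂ C.verts ∧
    ∀ S1 S2 : Set (Euc N), S1.Nonempty → S2.Nonempty →
      S1 ⊆ V1 → S2 ⊆ C.verts \ V1 → S1.ncard + S2.ncard ≤ k →
        ∃ F ∈ C.faces, vertSet F = S1 ∪ S2 ∧ setDim F + 1 = S1.ncard + S2.ncard

/-- A complex is `k`-neighborly if every nonempty subset of at most `k` of its vertices is
the vertex set of a face. -/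
def Neighborly {N : ℕ} (C : PolyComplex N) (k : ℕ) : Prop :=
  ∀ S : Set (Euc N), S ⊆ C.verts → S.Nonempty → S.ncard ≤ k →
    ∃ F ∈ C.faces, vertSet F = S

end PolyComplex

/-- `F` is a simplex: the convex hull of an affinely independent finite point set. -/
def IsSimplexSet {d : ℕ} (F : Set (Euc d)) : Prop :=
  ∃ S : Finset (Euc d),
    AffineIndependent ℝ (fun v : {x // x ∈ S} => (v : Euc d)) ∧
      F = convexHull ℝ (S : Set (Euc d))

/-- A simplicial polytope: all its proper faces are simplices. -/
def IsSimplicialPolytope {d : ℕ} (P : Set (Euc d)) : Prop :=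
  IsPolytope P ∧ ∀ F : Set (Euc d), IsProperFaceOf P F → IsSimplexSet F

/-- The collection `𝓕` of proper faces of the Cayley polytope of `P1`, `P2` having at least one
vertex in (the embedded copy of) each of `P1` and `P2`. -/
def cayleyFaces {d : ℕ} (P1 P2 : Set (Euc d)) : Set (Set (Euc (d + 1))) :=
  {F : Set (Euc (d + 1)) | IsProperFaceOf (cayley P1 P2) F ∧
    (vertSet F ∩ lift 0 '' P1).Nonempty ∧ (vertSet F ∩ lift 1 '' P2).Nonempty}

/-- `fFm1 P1 P2 k = f_{k-1}(𝓕)`, with the convention `f_{-1}(𝓕) = -1`. -/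
def fFm1 {d : ℕ} (P1 P2 : Set (Euc d)) : ℕ → ℤ
  | 0 => -1
  | (k + 1) => (({F ∈ cayleyFaces P1 P2 | setDim F = k} : Set (Set (Euc (d + 1)))).ncard : ℤ)

/-- The `h`-vector of `𝓕`: `h_k(𝓕) = ∑_{i=0}^{k} (-1)^{k-i} binom(d+1-i, d+1-k) f_{i-1}(𝓕)`. -/
def hF {d : ℕ} (P1 P2 : Set (Euc d)) (k : ℕ) : ℤ :=
  ∑ i ∈ Finset.range (k + 1),
    (-1 : ℤ) ^ (k - i) * ((d + 1 - i).choose (d + 1 - k) : ℤ) * fFm1 P1 P2 i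

/-- `fBdm1 P k = f_{k-1}(∂P)`, with `f_{-1}(∂P) = 1`. -/
def fBdm1 {d : ℕ} (P : Set (Euc d)) : ℕ → ℤ
  | 0 => 1
  | (k + 1) => (faceCount P k : ℤ)

/-- The `h`-vector of the boundary complex of a `d`-polytope `P ⊆ E^d`:
`h_k(∂P) = ∑_{i=0}^{k} (-1)^{k-i} binom(d-i, d-k) f_{i-1}(∂P)`. -/
def hBd {d : ℕ} (P : Set (Euc d)) (k : ℕ) : ℤ :=
  ∑ i ∈ Finset.range (k + 1),
    (-1 : ℤ) ^ (k - i) * ((d - i).choose (d - k) : ℤ) * fBdm1 P i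

/-- The `g`-vector of `∂P`: `g_0 = h_0 (= 1)` and `g_k = h_k - h_{k-1}`, with the
convention `h_{d+1}(∂P) = 0`. -/
def gBd {d : ℕ} (P : Set (Euc d)) (k : ℕ) : ℤ :=
  (if k ≤ d then hBd P k else 0)
    - (if k = 0 then 0 else if k - 1 ≤ d then hBd P (k - 1) else 0)

/-- `fCycm1 δ n k = f_{k-1}(C_δ(n))`, with `f_{-1} = 1`. -/
def fCycm1 (δ n k : ℕ) : ℤ :=
  if k = 0 then 1 else (faceCount (cyclicPolytope δ n) (k - 1) : ℤ)

/-- The upper bound for `f_{k-1}(𝓕)`: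
`f_{k-1}(C_{d+1}(n1+n2)) - ∑_{i=0}^{⌊(d+1)/2⌋} binom(d+1-i, k-i)(binom(n1-d-2+i,i)+binom(n2-d-2+i,i))`. -/
def cayleyBound (d n1 n2 k : ℕ) : ℤ :=
  fCycm1 (d + 1) (n1 + n2) k
    - ∑ i ∈ Finset.range ((d + 1) / 2 + 1),
        (if i ≤ k then ((d + 1 - i).choose (k - i) : ℤ) else 0)
          * ((ubTerm n1 d i : ℤ) + (ubTerm n2 d i : ℤ))

/-- The moment-like curve `γ1(t; ζ) = (t, ζ t^d, t², t³, …, t^{d-1}, 0)` in `E^{d+1}`. -/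
def gamma1 (d : ℕ) (ζ t : ℝ) : Euc (d + 1) := fun i =>
  if (i : ℕ) = 0 then t
  else if (i : ℕ) = 1 then ζ * t ^ d
  else if (i : ℕ) = d then 0
  else t ^ (i : ℕ)

/-- The moment-like curve `γ2(s; ζ) = (ζ s^d, s, s², s³, …, s^{d-1}, 1)` in `E^{d+1}`. -/
def gamma2 (d : ℕ) (ζ s : ℝ) : Euc (d + 1) := fun i =>
  if (i : ℕ) = 0 then ζ * s ^ d
  else if (i : ℕ) = 1 then s
  else if (i : ℕ) = d then 1
  else s ^ (i : ℕ)

/-- The `(k+ℓ) × (k+ℓ)` matrix whose determinant is `D_{k,ℓ}(τ)`: rows are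
`(1,…,1,0,…,0)`, `(x₁τ,…,x_kτ,0,…,0)`, `(0,…,0,1,…,1)`, `(0,…,0,y₁,…,y_ℓ)` and
`(x₁^pτ^p,…,x_k^pτ^p,y₁^p,…,y_ℓ^p)` for `p = 2, …, k+ℓ-3`. -/
def Dmat (k l : ℕ) (x : Fin k → ℝ) (y : Fin l → ℝ) (τ : ℝ) :
    Matrix (Fin (k + l)) (Fin (k + l)) ℝ :=
  Matrix.of fun r c =>
    have hcl : (c : ℕ) < k + l := c.isLt
    if hc : (c : ℕ) < k then
      if (r : ℕ) = 0 then 1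
      else if (r : ℕ) = 1 then x ⟨(c : ℕ), hc⟩ * τ
      else if (r : ℕ) = 2 then 0
      else if (r : ℕ) = 3 then 0
      else (x ⟨(c : ℕ), hc⟩ * τ) ^ ((r : ℕ) - 2)
    else
      have hck : (c : ℕ) - k < l := by omega
      if (r : ℕ) = 0 then 0
      else if (r : ℕ) = 1 then 0
      else if (r : ℕ) = 2 then 1
      else if (r : ℕ) = 3 then y ⟨(c : ℕ) - k, hck⟩
      else y ⟨(c : ℕ) - k, hck⟩ ^ ((r : ℕ) - 2)

/-- The exponent vector `μ = (0, 1, k, k+1, …, k+ℓ-3)`. -/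
def muExp (k i : ℕ) : ℕ := if i = 0 then 0 else if i = 1 then 1 else k + i - 2

/-- The Vandermonde determinant `VD(x) = ∏_{i<j} (x_j - x_i)`. -/
def VDprod {k : ℕ} (x : Fin k → ℝ) : ℝ :=
  ∏ p ∈ Finset.univ.filter (fun p : Fin k × Fin k => p.1 < p.2), (x p.2 - x p.1)

/-- The generalized Vandermonde determinant `GVD(y; μ) = det (y_j^{μ_i})` with exponent
vector `μ = (0, 1, k, k+1, …, k+ℓ-3)`. -/
def GVDdet (k : ℕ) {l : ℕ} (y : Fin l → ℝ) : ℝ :=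
  (Matrix.of fun i j : Fin l => y j ^ muExp k (i : ℕ)).det

/-- `binom(a, b)` for an integer lower index, zero when `b < 0` or `b > a`. -/
def zchoose (a : ℕ) (b : ℤ) : ℝ := if 0 ≤ b then (a.choose b.toNat : ℝ) else 0

/-- An open order-connected set of reals is an interval with extended real end points. -/
theorem exists_ereal_Ioo {I : Set ℝ} (ho : IsOpen I) (hc : I.OrdConnected) :
    ∃ a b : EReal, ∀ t : ℝ, t ∈ I ↔ a < t ∧ (t : EReal) < b := by
  refine ⟨sInf ((fun t : ℝ => (t : EReal)) '' I), sSup ((fun t : ℝ => (t : EReal)) '' I),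
    fun t => ⟨fun ht => ?_, fun ⟨h1, h2⟩ => ?_⟩⟩
  · obtain ⟨ε, hε, hb⟩ := Metric.isOpen_iff.1 ho t ht
    have h1 : t - ε / 2 ∈ I := hb (by
      rw [Metric.mem_ball, Real.dist_eq, show t - ε / 2 - t = -(ε / 2) by ring, abs_neg,
        abs_of_pos (by linarith)]
      linarith)
    have h2 : t + ε / 2 ∈ I := hb (by
      rw [Metric.mem_ball, Real.dist_eq, show t + ε / 2 - t = ε / 2 by ring,
        abs_of_pos (by linarith)]
      linarith)
    constructor
    · refine lt_of_le_of_lt (sInf_le ⟨_, h1, rfl⟩) ?_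
      exact EReal.coe_lt_coe_iff.2 (by linarith)
    · refine lt_of_lt_of_le ?_ (le_sSup ⟨_, h2, rfl⟩)
      exact EReal.coe_lt_coe_iff.2 (by linarith)
  · obtain ⟨_, ⟨x, hx, rfl⟩, hxt⟩ := sInf_lt_iff.1 h1
    obtain ⟨_, ⟨y, hy, rfl⟩, hty⟩ := lt_sSup_iff.1 h2
    exact hc.out hx hy ⟨(EReal.coe_lt_coe_iff.1 hxt).le, (EReal.coe_lt_coe_iff.1 hty).le⟩

/-- `I` is a point of the line and `ε = 1`, or a nonempty open interval and `ε = -1`. -/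
def IsLineCell (I : Set ℝ) (ε : ℤ) : Prop :=
  (∃ t, I = {t} ∧ ε = 1) ∨ (IsOpen I ∧ I.OrdConnected ∧ I.Nonempty ∧ ε = -1)

open Classical in
/-- Euler characteristics of cells of the line respect linear relations of indicators. -/
theorem sum_lineCell_eq_zero {ι : Type*} (s : Finset ι) (b ε : ι → ℤ) (I : ι → Set ℝ)
    (hI : ∀ i ∈ s, IsLineCell (I i) (ε i))
    (h : ∀ t : ℝ, ∑ i ∈ s, (if t ∈ I i then b i else 0) = 0) :
    ∑ i ∈ s, b i * ε i = 0 := by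
  -- `κ i` is the left end of the cell; just right of `c` the cell has indicator `r i`
  have key : ∀ i ∈ s, ∃ κ : EReal, κ < ⊤ ∧ ∀ c : EReal, c < ⊤ → ∃ r : ℤ,
      (∀ᶠ x : EReal in nhdsWithin c (Ioi c), ∀ t : ℝ, (t : EReal) = x →
        (if t ∈ I i then (1 : ℤ) else 0) = r) ∧
      (if ∃ t : ℝ, (t : EReal) = c ∧ t ∈ I i then (1 : ℤ) else 0) - r =
        if κ = c then ε i else 0 := by
    intro i hi
    rcases hI i hi with ⟨t, hI, he⟩ | ⟨ho, hc, ⟨t0, ht0⟩, he⟩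
    · refine ⟨t, EReal.coe_lt_top t, fun c hc => ⟨0, ?_, ?_⟩⟩
      · rcases lt_or_ge c t with hct | hct
        · filter_upwards [Ioo_mem_nhdsGT hct] with x hx u hu
          rw [if_neg]
          rintro hu'
          rw [hI] at hu'
          rw [← hu, hu'] at hx
          exact lt_irrefl _ hx.2
        · filter_upwards [self_mem_nhdsWithin] with x hx u hu
          rw [if_neg]
          rintro hu'
          rw [hI] at hu'
          rw [← hu, hu'] at hx
          exact absurd hct (not_le.2 hx)
      · by_cases hct : (t : EReal) = c
        · rw [if_pos hct, if_pos ⟨t, hct, by rw [hI]; rfl⟩, he, sub_zero]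
        · rw [if_neg hct, if_neg, sub_zero]
          rintro ⟨u, hu, hu'⟩
          rw [hI] at hu'
          exact hct (by rw [← hu, hu'])
    · obtain ⟨a, b, hab⟩ := exists_ereal_Ioo ho hc
      have hlt : a < b := ((hab t0).1 ht0).1.trans ((hab t0).1 ht0).2
      refine ⟨a, lt_of_lt_of_le hlt le_top,
        fun c hc => ⟨if a ≤ c ∧ c < b then 1 else 0, ?_, ?_⟩⟩
      · have h1 : ∀ᶠ x in nhdsWithin c (Ioi c), (a < x ↔ a ≤ c) := by
          rcases lt_or_ge c a with hca | hca
          · filter_upwards [Ioo_mem_nhdsGT hca] with x hx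
            exact ⟨fun h => absurd (h.trans hx.2) (lt_irrefl _),
              fun h => absurd (lt_of_lt_of_le hca h) (lt_irrefl _)⟩
          · filter_upwards [self_mem_nhdsWithin] with x hx
            exact ⟨fun _ => hca, fun _ => lt_of_le_of_lt hca hx⟩
        have h2 : ∀ᶠ x in nhdsWithin c (Ioi c), (x < b ↔ c < b) := by
          rcases lt_or_ge c b with hca | hca
          · filter_upwards [Ioo_mem_nhdsGT hca] with x hx
            exact ⟨fun _ => hca, fun _ => hx.2⟩
          · filter_upwards [self_mem_nhdsWithin] with x hx
            exact ⟨fun h => lt_trans hx h,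
              fun h => absurd (lt_of_lt_of_le h hca) (lt_irrefl _)⟩
        filter_upwards [h1, h2] with x h1 h2 t ht
        subst ht
        simp only [hab, h1, h2]
      · have : (∃ t : ℝ, (t : EReal) = c ∧ t ∈ I i) ↔ a < c ∧ c < b := by
          constructor
          · rintro ⟨t, rfl, ht⟩
            exact (hab t).1 ht
          · rintro ⟨h1, h2⟩
            have hc' : ((c.toReal : ℝ) : EReal) = c :=
              EReal.coe_toReal hc.ne (lt_of_le_of_lt bot_le h1).ne'
            exact ⟨c.toReal, hc', (hab _).2 (by rw [hc']; exact ⟨h1, h2⟩)⟩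
        simp only [this, he]
        rcases lt_trichotomy a c with hac | hac | hac
        · simp [hac, hac.le, hac.ne]
        · subst hac
          simp [hlt]
        · simp [hac.not_ge, hac.ne', hac.not_gt]
  choose! κ hκ r hr1 hr2 using key
  have fib : ∀ c : EReal, c < ⊤ → ∑ i ∈ s with κ i = c, b i * ε i = 0 := by
    intro c hc
    have hright : ∑ i ∈ s, b i * r i c = 0 := by
      have hev : ∀ᶠ x : EReal in nhdsWithin c (Ioi c), ∀ i ∈ s, ∀ t : ℝ, (t : EReal) = x →
          (if t ∈ I i then (1 : ℤ) else 0) = r i c :=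
        (Filter.eventually_all_finset s).2 fun i hi => hr1 i hi c hc
      have : (nhdsWithin c (Ioi c)).NeBot := nhdsGT_neBot_of_exists_gt ⟨⊤, hc⟩
      obtain ⟨x, hx, hxc⟩ := (hev.and (Ioo_mem_nhdsGT hc)).exists
      have hx' : ((x.toReal : ℝ) : EReal) = x :=
        EReal.coe_toReal hxc.2.ne (lt_of_le_of_lt bot_le hxc.1).ne'
      rw [← h x.toReal]
      refine Finset.sum_congr rfl fun i hi => ?_
      rw [← hx i hi _ hx']
      split_ifs <;> simp
    have hat : ∑ i ∈ s, b i * (if ∃ t : ℝ, (t : EReal) = c ∧ t ∈ I i then (1 : ℤ) else 0) = 0 := by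
      by_cases hb : ∃ t : ℝ, (t : EReal) = c
      · obtain ⟨t, rfl⟩ := hb
        refine (Finset.sum_congr rfl fun i hi => ?_).trans (h t)
        have : (∃ u : ℝ, (u : EReal) = t ∧ u ∈ I i) ↔ t ∈ I i := by
          constructor
          · rintro ⟨u, hu, hu'⟩
            rwa [← EReal.coe_injective hu]
          · exact fun h => ⟨t, rfl, h⟩
        simp only [this]
        split_ifs <;> simp
      · refine Finset.sum_eq_zero fun i hi => ?_
        rw [if_neg, mul_zero]
        rintro ⟨t, ht, -⟩
        exact hb ⟨t, ht⟩
    rw [Finset.sum_filter]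
    refine Eq.trans ?_ (sub_eq_zero.2 (hat.trans hright.symm))
    rw [← Finset.sum_sub_distrib]
    refine Finset.sum_congr rfl fun i hi => ?_
    rw [← mul_sub, hr2 i hi c hc, mul_ite, mul_zero]
  rw [← Finset.sum_fiberwise_of_maps_to (t := s.image κ) (g := κ)
    fun i hi => Finset.mem_image_of_mem _ hi]
  refine Finset.sum_eq_zero fun c hc => fib c ?_
  obtain ⟨i, hi, rfl⟩ := Finset.mem_image.1 hc
  exact hκ i hi

/-- `C` is a nonempty intersection of an open convex set with a translate of `W`. -/
def IsRelOpen {E : Type*} [AddCommGroup E] [Module ℝ E] [TopologicalSpace E]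
    (W : Submodule ℝ E) (C : Set E) : Prop :=
  ∃ U : Set E, IsOpen U ∧ Convex ℝ U ∧ ∃ p ∈ U, C = {x | x ∈ U ∧ x - p ∈ W}

/-- The embedding of `ℝⁿ` as the kernel of the first coordinate of `ℝⁿ⁺¹`. -/
def consZero (n : ℕ) : (Fin n → ℝ) →ₗ[ℝ] (Fin (n + 1) → ℝ) where
  toFun y := Fin.cons 0 y
  map_add' x y := by
    ext i
    refine Fin.cases ?_ (fun j => ?_) i <;> simp
  map_smul' c y := by
    ext i
    refine Fin.cases ?_ (fun j => ?_) i <;> simp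

theorem cons_sub_cons {n : ℕ} (t : ℝ) (x y : Fin n → ℝ) :
    (Fin.cons t x - Fin.cons t y : Fin (n + 1) → ℝ) = consZero n (x - y) := by
  ext i
  refine Fin.cases ?_ (fun j => ?_) i <;> simp [consZero]

theorem map_comap_consZero {n : ℕ} (W : Submodule ℝ (Fin (n + 1) → ℝ)) :
    (W.comap (consZero n)).map (consZero n) =
      W ⊓ LinearMap.ker (LinearMap.proj (R := ℝ) (φ := fun _ : Fin (n + 1) => ℝ) 0) := by
  rw [Submodule.map_comap_eq, inf_comm]
  congr 1
  ext x
  constructor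
  · rintro ⟨y, rfl⟩
    simp [consZero]
  · intro hx
    have hx : x 0 = 0 := by simpa using hx
    refine ⟨Fin.tail x, ?_⟩
    change Fin.cons 0 (Fin.tail x) = x
    rw [← hx, Fin.cons_self_tail]

theorem consZero_injective (n : ℕ) : Function.Injective (consZero n) :=
  fun _ _ h => Fin.cons_right_injective (α := fun _ => ℝ) 0 h

/-- The dimension of a horizontal slice of a subspace. -/
theorem finrank_comap_consZero {n : ℕ} (W : Submodule ℝ (Fin (n + 1) → ℝ)) :
    (Module.finrank ℝ (W.comap (consZero n)) = Module.finrank ℝ W ∧ ∀ v ∈ W, v 0 = 0) ∨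
    (Module.finrank ℝ (W.comap (consZero n)) + 1 = Module.finrank ℝ W ∧
      ∃ v ∈ W, v 0 = 1) := by
  have h1 : Module.finrank ℝ (W.comap (consZero n)) = Module.finrank ℝ
      ↥(W ⊓ LinearMap.ker (LinearMap.proj (R := ℝ) (φ := fun _ : Fin (n + 1) => ℝ) 0)) := by
    rw [← map_comap_consZero]
    exact (Submodule.equivMapOfInjective _ (consZero_injective n) _).finrank_eq
  set φ := LinearMap.proj (R := ℝ) (φ := fun _ : Fin (n + 1) => ℝ) 0 with hφ
  by_cases hW : ∀ v ∈ W, v 0 = 0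
  · left
    refine ⟨?_, hW⟩
    rw [h1, inf_eq_left.2]
    intro v hv
    exact hW v hv
  · right
    push Not at hW
    obtain ⟨v, hv, hv0⟩ := hW
    have hex : ∃ v ∈ W, v 0 = 1 := ⟨(v 0)⁻¹ • v, W.smul_mem _ hv, by simp [hv0]⟩
    refine ⟨?_, hex⟩
    obtain ⟨w, hw, hw1⟩ := hex
    have hsurj : LinearMap.range (φ.domRestrict W) = ⊤ := by
      rw [LinearMap.range_eq_top]
      intro c
      refine ⟨c • ⟨w, hw⟩, ?_⟩
      simp [hφ, hw1]
    have hrn := LinearMap.finrank_range_add_finrank_ker (φ.domRestrict W)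
    rw [hsurj, finrank_top, Module.finrank_self] at hrn
    rw [h1, ← hrn, add_comm]
    congr 1
    rw [LinearMap.ker_domRestrict, ← Submodule.finrank_map_subtype_eq, Submodule.map_comap_subtype]

theorem IsRelOpen.base_change {E : Type*} [AddCommGroup E] [Module ℝ E]
    {W : Submodule ℝ E} {U : Set E} {p q : E} (hq : q - p ∈ W) :
    {x | x ∈ U ∧ x - p ∈ W} = {x | x ∈ U ∧ x - q ∈ W} := by
  ext x
  refine and_congr_right fun _ => ?_
  constructor
  · intro h
    simpa using W.sub_mem h hq
  · intro h
    simpa using W.add_mem h hq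

/-- Slices of relatively open convex sets are relatively open convex, over a cell of the line. -/
theorem IsRelOpen.slice {n : ℕ} {W : Submodule ℝ (Fin (n + 1) → ℝ)} {C : Set (Fin (n + 1) → ℝ)}
    (h : IsRelOpen W C) :
    ∃ (I : Set ℝ) (ε : ℤ), IsLineCell I ε ∧
      (-1 : ℤ) ^ Module.finrank ℝ W = ε * (-1) ^ Module.finrank ℝ (W.comap (consZero n)) ∧
      (∀ t ∈ I, IsRelOpen (W.comap (consZero n)) {y | (Fin.cons t y : Fin (n + 1) → ℝ) ∈ C}) ∧
      ∀ t, ∀ y : Fin n → ℝ, (Fin.cons t y : Fin (n + 1) → ℝ) ∈ C → t ∈ I := by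
  obtain ⟨U, hUo, hUc, p, hpU, hC⟩ := h
  have hcons : ∀ t : ℝ, Continuous fun y : Fin n → ℝ => (Fin.cons t y : Fin (n + 1) → ℝ) :=
    fun t => by fun_prop
  have hslice : ∀ q ∈ C, IsRelOpen (W.comap (consZero n))
      {y | (Fin.cons (q 0) y : Fin (n + 1) → ℝ) ∈ C} := by
    intro q hq
    rw [hC] at hq
    refine ⟨{y | (Fin.cons (q 0) y : Fin (n + 1) → ℝ) ∈ U}, hUo.preimage (hcons _), ?_,
      Fin.tail q, ?_, ?_⟩
    · intro x hx y hy a b ha hb hab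
      have := hUc hx hy ha hb hab
      have he : (Fin.cons (q 0) (a • x + b • y) : Fin (n + 1) → ℝ) =
          a • (Fin.cons (q 0) x : Fin (n + 1) → ℝ) + b • (Fin.cons (q 0) y) := by
        ext i
        refine Fin.cases ?_ (fun j => ?_) i
        · simp [← add_mul, hab]
        · simp
      rw [mem_ofPred_eq, he]
      exact this
    · rw [mem_ofPred_eq, Fin.cons_self_tail]
      exact hq.1
    · ext y
      rw [hC, IsRelOpen.base_change hq.2]
      simp only [mem_ofPred_eq, Submodule.mem_comap, ← cons_sub_cons (q 0), Fin.cons_self_tail]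
  have hI : ∀ t ∈ (fun x : Fin (n + 1) → ℝ => x 0) '' C,
      IsRelOpen (W.comap (consZero n)) {y | (Fin.cons t y : Fin (n + 1) → ℝ) ∈ C} := by
    rintro _ ⟨q, hq, rfl⟩
    exact hslice q hq
  have hI' : ∀ t, ∀ y : Fin n → ℝ, (Fin.cons t y : Fin (n + 1) → ℝ) ∈ C →
      t ∈ (fun x : Fin (n + 1) → ℝ => x 0) '' C := fun t y hy => ⟨_, hy, by simp⟩
  have hpC : p ∈ C := by rw [hC]; exact ⟨hpU, by simp⟩
  rcases finrank_comap_consZero W with ⟨hr, hW⟩ | ⟨hr, w, hw, hw1⟩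
  · refine ⟨_, 1, Or.inl ⟨p 0, ?_, rfl⟩, by rw [hr, one_mul], hI, hI'⟩
    ext t
    constructor
    · rintro ⟨x, hx, rfl⟩
      rw [hC] at hx
      have := hW _ hx.2
      simpa [sub_eq_zero] using this
    · rintro rfl
      exact ⟨p, hpC, rfl⟩
  · refine ⟨(fun x : Fin (n + 1) → ℝ => x 0) '' C, -1, Or.inr ⟨?_, ?_, ⟨_, p, hpC, rfl⟩, rfl⟩, by rw [← hr]; ring, hI, hI'⟩
    · rw [isOpen_iff_mem_nhds]
      rintro _ ⟨x, hx, rfl⟩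
      rw [hC] at hx
      have hc : Continuous fun t : ℝ => x + (t - x 0) • w := by fun_prop
      have : (fun t : ℝ => x + (t - x 0) • w) ⁻¹' U ∈ nhds (x 0) :=
        hc.continuousAt.preimage_mem_nhds (by simpa using hUo.mem_nhds hx.1)
      filter_upwards [this] with t ht
      refine ⟨x + (t - x 0) • w, ?_, by simp [hw1]⟩
      rw [hC]
      refine ⟨ht, ?_⟩
      rw [add_sub_right_comm]
      exact W.add_mem hx.2 (W.smul_mem _ hw)
    · have hconv : Convex ℝ C := by
        rw [hC]
        intro x hx y hy a b ha hb hab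
        refine ⟨hUc hx.1 hy.1 ha hb hab, ?_⟩
        have : a • x + b • y - p = a • (x - p) + b • (y - p) := by
          rw [smul_sub, smul_sub, sub_add_sub_comm, ← add_smul, hab, one_smul]
        rw [this]
        exact W.add_mem (W.smul_mem _ hx.2) (W.smul_mem _ hy.2)
      exact (hconv.is_linear_image (f := fun x : Fin (n + 1) → ℝ => x 0)
        ⟨fun _ _ => rfl, fun _ _ => rfl⟩).ordConnected

open Classical in
/-- Signed counts of relatively open convex sets respect linear relations of indicators. -/
theorem sum_relOpen_eq_zero (n : ℕ) {ι : Type*} (s : Finset ι) (a : ι → ℤ)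
    (W : ι → Submodule ℝ (Fin n → ℝ)) (C : ι → Set (Fin n → ℝ))
    (hC : ∀ i ∈ s, IsRelOpen (W i) (C i))
    (h : ∀ x, ∑ i ∈ s, (if x ∈ C i then a i else 0) = 0) :
    ∑ i ∈ s, a i * (-1) ^ Module.finrank ℝ (W i) = 0 := by
  induction n generalizing s with
  | zero =>
    refine (Finset.sum_congr rfl fun i hi => ?_).trans (h 0)
    obtain ⟨U, -, -, p, hp, hCi⟩ := hC i hi
    have : (0 : Fin 0 → ℝ) ∈ C i := by
      rw [hCi, Subsingleton.elim (0 : Fin 0 → ℝ) p]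
      exact ⟨hp, by rw [sub_self]; exact (W i).zero_mem⟩
    rw [if_pos this, Module.finrank_zero_of_subsingleton, pow_zero, mul_one]
  | succ n ih =>
    choose! I ε hcell hsign hmem hout using fun i hi => (hC i hi).slice
    have := sum_lineCell_eq_zero s
      (fun i => a i * (-1) ^ Module.finrank ℝ ((W i).comap (consZero n))) ε I hcell fun t => by
        rw [← Finset.sum_filter]
        refine ih (s.filter fun i => t ∈ I i) (fun i => (W i).comap (consZero n))
          (fun i => {y | (Fin.cons t y : Fin (n + 1) → ℝ) ∈ C i}) ?_ ?_
        · intro i hi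
          rw [Finset.mem_filter] at hi
          exact hmem i hi.1 t hi.2
        · intro y
          refine Eq.trans ?_ (h (Fin.cons t y))
          rw [Finset.sum_filter]
          refine Finset.sum_congr rfl fun i hi => ?_
          by_cases hy : (Fin.cons t y : Fin (n + 1) → ℝ) ∈ C i
          · simp [hy, hout i hi t y hy]
          · simp [hy]
    rw [← this]
    refine Finset.sum_congr rfl fun i hi => ?_
    rw [hsign i hi]
    ring

/-- Signed counts of polyhedral cells of a finite-dimensional space respect linear relations of
indicators. -/
theorem sum_cell_eq_zero {E : Type*} [AddCommGroup E] [Module ℝ E] [FiniteDimensional ℝ E]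
    {ι α : Type*} (s : Finset ι) (a : ι → ℤ) (W : ι → Submodule ℝ E) (J : ι → Finset α)
    (ψ : ι → α → E →ₗ[ℝ] ℝ) (C : ι → Set E)
    (hC : ∀ i ∈ s, ∀ x, x ∈ C i ↔ x ∈ W i ∧ ∀ v ∈ J i, 0 < ψ i v x)
    (hne : ∀ i ∈ s, (C i).Nonempty)
    (h : ∀ x, ∑ i ∈ s, (C i).indicator (fun _ => a i) x = 0) :
    ∑ i ∈ s, a i * (-1) ^ Module.finrank ℝ (W i) = 0 := by
  classical
  let e : E ≃ₗ[ℝ] (Fin (Module.finrank ℝ E) → ℝ) := (Module.finBasis ℝ E).equivFun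
  have := sum_relOpen_eq_zero _ s a (fun i => (W i).map (e : E →ₗ[ℝ] _))
    (fun i => e.symm ⁻¹' C i) ?_ ?_
  · rw [← this]
    refine Finset.sum_congr rfl fun i _ => ?_
    rw [LinearEquiv.finrank_map_eq]
  · intro i hi
    obtain ⟨p, hp⟩ := hne i hi
    have hp' := (hC i hi p).1 hp
    refine ⟨{x | ∀ v ∈ J i, 0 < ψ i v (e.symm x)}, ?_, ?_, e p, ?_, ?_⟩
    · have : {x | ∀ v ∈ J i, 0 < ψ i v (e.symm x)} =
          ⋂ v ∈ J i, {x | 0 < (ψ i v ∘ₗ (e.symm : _ →ₗ[ℝ] E)) x} := by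
        ext x
        simp
      rw [this]
      exact isOpen_biInter_finset fun v _ =>
        isOpen_lt continuous_const (LinearMap.continuous_of_finiteDimensional _)
    · intro x hx y hy b c hb hc hbc v hv
      have h1 := hx v hv
      have h2 := hy v hv
      rw [map_add, map_smul, map_smul, map_add, map_smul, map_smul, smul_eq_mul, smul_eq_mul]
      rcases hb.eq_or_lt with rfl | hb
      · rw [zero_add] at hbc
        subst hbc
        simpa using h2
      · exact add_pos_of_pos_of_nonneg (mul_pos hb h1) (mul_nonneg hc h2.le)
    · intro v hv
      rw [LinearEquiv.symm_apply_apply]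
      exact hp'.2 v hv
    · ext x
      have hx : x - e p ∈ (W i).map (e : E →ₗ[ℝ] _) ↔ e.symm x ∈ W i := by
        have h1 : x - e p ∈ (W i).map (e : E →ₗ[ℝ] _) ↔ x ∈ (W i).map (e : E →ₗ[ℝ] _) :=
          Submodule.sub_mem_iff_left _ ⟨p, hp'.1, rfl⟩
        rw [h1]
        exact Submodule.mem_map_equiv (e := e) (W i)
      rw [mem_preimage, hC i hi]
      exact ⟨fun h => ⟨h.2, hx.2 h.1⟩, fun h => ⟨hx.1 h.2, h.1⟩⟩
  · intro x
    refine (Finset.sum_congr rfl fun i _ => ?_).trans (h (e.symm x))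
    rw [Set.indicator_apply]
    rfl

/-- The common zeros of the functionals indexed by `S`. -/
def zeroSpace {E α : Type*} [AddCommGroup E] [Module ℝ E] (φ : α → E →ₗ[ℝ] ℝ) (S : Finset α) :
    Submodule ℝ E :=
  ⨅ v ∈ S, LinearMap.ker (φ v)

theorem mem_zeroSpace {E α : Type*} [AddCommGroup E] [Module ℝ E] {φ : α → E →ₗ[ℝ] ℝ}
    {S : Finset α} {x : E} : x ∈ zeroSpace φ S ↔ ∀ v ∈ S, φ v x = 0 := by
  simp [zeroSpace]

/-- `S` is the zero set in `V` of a vector on which the functionals are nonnegative. -/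
def IsFaceSet {E α : Type*} [AddCommGroup E] [Module ℝ E] (φ : α → E →ₗ[ℝ] ℝ) (V S : Finset α) :
    Prop :=
  S ⊆ V ∧ ∃ x : E, ∀ v ∈ V, 0 ≤ φ v x ∧ (φ v x = 0 ↔ v ∈ S)

open Classical in
/-- The faces of a vector configuration form an Eulerian poset. -/
theorem sum_faceSet_eq_zero {E α : Type*} [AddCommGroup E] [Module ℝ E] [FiniteDimensional ℝ E]
    (φ : α → E →ₗ[ℝ] ℝ) {V F : Finset α} (hF : IsFaceSet φ V F) (hFV : F ≠ V) :
    ∑ S ∈ V.powerset with IsFaceSet φ V S ∧ F ⊆ S,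
      (-1 : ℤ) ^ Module.finrank ℝ (zeroSpace φ S) = 0 := by
  obtain ⟨hFsub, x₀, hx₀⟩ := hF
  have hpos : ∀ v ∈ V, v ∉ F → 0 < φ v x₀ := fun v hv hvF =>
    lt_of_le_of_ne (hx₀ v hv).1 fun h => hvF ((hx₀ v hv).2.1 h.symm)
  have hzero : ∀ v ∈ F, φ v x₀ = 0 := fun v hv => (hx₀ v (hFsub hv)).2.2 hv
  set s : Finset (Finset α) := {S ∈ V.powerset | IsFaceSet φ V S ∧ F ⊆ S} with hs
  have hFs : F ∈ s := by
    simp only [hs, Finset.mem_filter, Finset.mem_powerset]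
    exact ⟨hFsub, ⟨hFsub, x₀, hx₀⟩, subset_rfl⟩
  have hex : ∀ S ∈ s.erase F, ∃ v ∈ S, v ∉ F := by
    intro S hS
    simp only [hs, Finset.mem_erase, Finset.mem_filter] at hS
    by_contra! hcon
    exact hS.1 (Finset.Subset.antisymm hcon hS.2.2.2)
  have hne : (V \ F).Nonempty := by
    rw [Finset.sdiff_nonempty]
    exact fun h => hFV (Finset.Subset.antisymm hFsub h)
  have : Nonempty α := ⟨hne.choose⟩
  choose! v₀ hv₀S hv₀F using hex
  have hsV : ∀ S ∈ s.erase F, S ⊆ V := fun S hS => by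
    simp only [hs, Finset.mem_erase, Finset.mem_filter, Finset.mem_powerset] at hS
    exact hS.2.1
  have hv₀pos : ∀ S ∈ s.erase F, 0 < φ (v₀ S) x₀ := fun S hS =>
    hpos _ (hsV S hS (hv₀S S hS)) (hv₀F S hS)
  -- the projection along `x₀` onto the kernel of `φ (v₀ S)`
  let P : Finset α → E →ₗ[ℝ] E := fun S =>
    LinearMap.id - ((φ (v₀ S) x₀)⁻¹ • φ (v₀ S)).smulRight x₀
  have hP : ∀ S x, P S x = x - ((φ (v₀ S) x₀)⁻¹ * φ (v₀ S) x) • x₀ := fun S x => by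
    simp [P]
  let cell : Finset α → Set E := fun S =>
    {x | ∃ c : ℝ, ∀ v ∈ V, 0 ≤ φ v (x - c • x₀) ∧ (φ v (x - c • x₀) = 0 ↔ v ∈ S)}
  have hcell : ∀ S ∈ s.erase F, ∀ x, x ∈ cell S ↔
      x ∈ (zeroSpace φ S).comap (P S) ∧ ∀ v ∈ V \ S, 0 < (φ v ∘ₗ P S) x := by
    intro S hS x
    rw [Submodule.mem_comap, mem_zeroSpace]
    constructor
    · rintro ⟨c, hc⟩
      have h0 : φ (v₀ S) (x - c • x₀) = 0 := (hc _ (hsV S hS (hv₀S S hS))).2.2 (hv₀S S hS)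
      have hcc : (φ (v₀ S) x₀)⁻¹ * φ (v₀ S) x = c := by
        rw [map_sub, map_smul, smul_eq_mul, sub_eq_zero] at h0
        rw [h0, mul_comm, mul_assoc, mul_inv_cancel₀ (hv₀pos S hS).ne', mul_one]
      simp only [LinearMap.comp_apply, hP, hcc]
      refine ⟨fun v hv => (hc v (hsV S hS hv)).2.2 hv, fun v hv => ?_⟩
      rw [Finset.mem_sdiff] at hv
      exact lt_of_le_of_ne (hc v hv.1).1 fun h => hv.2 ((hc v hv.1).2.1 h.symm)
    · rintro ⟨h1, h2⟩
      refine ⟨(φ (v₀ S) x₀)⁻¹ * φ (v₀ S) x, fun v hv => ?_⟩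
      rw [← hP]
      by_cases hvS : v ∈ S
      · exact ⟨(h1 v hvS).ge, fun _ => hvS, fun _ => h1 v hvS⟩
      · have := h2 v (Finset.mem_sdiff.2 ⟨hv, hvS⟩)
        exact ⟨this.le, fun h => absurd h this.ne', fun h => absurd h hvS⟩
  have hdim : ∀ S ∈ s.erase F, Module.finrank ℝ ((zeroSpace φ S).comap (P S)) =
      Module.finrank ℝ (zeroSpace φ S) + 1 := by
    intro S hS
    have heq : (zeroSpace φ S).comap (P S) = zeroSpace φ S ⊔ Submodule.span ℝ {x₀} := by
      apply le_antisymm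
      · intro x hx
        rw [Submodule.mem_comap, hP] at hx
        rw [Submodule.mem_sup]
        exact ⟨_, hx, _, Submodule.smul_mem _ _ (Submodule.mem_span_singleton_self x₀),
          sub_add_cancel _ _⟩
      · rw [sup_le_iff, Submodule.span_singleton_le_iff_mem]
        constructor
        · intro x hx
          rw [Submodule.mem_comap, hP, mem_zeroSpace.1 hx _ (hv₀S S hS)]
          simpa using hx
        · rw [Submodule.mem_comap, hP, inv_mul_cancel₀ (hv₀pos S hS).ne']
          simp
    have hx₀S : x₀ ∉ zeroSpace φ S := fun h =>
      (hv₀pos S hS).ne' (mem_zeroSpace.1 h _ (hv₀S S hS))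
    have hx₀0 : x₀ ≠ 0 := fun h => hx₀S (h ▸ Submodule.zero_mem _)
    have hdisj : zeroSpace φ S ⊓ Submodule.span ℝ {x₀} = ⊥ :=
      disjoint_iff.1 (((Submodule.disjoint_span_singleton' hx₀0).2 hx₀S))
    have := Submodule.finrank_sup_add_finrank_inf_eq (zeroSpace φ S) (Submodule.span ℝ {x₀})
    rw [hdisj, finrank_bot, finrank_span_singleton hx₀0] at this
    rw [heq]
    omega
  have hcellne : ∀ S ∈ s.erase F, (cell S).Nonempty := by
    intro S hS
    simp only [hs, Finset.mem_erase, Finset.mem_filter] at hS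
    obtain ⟨-, x, hx⟩ := hS.2.2.1
    exact ⟨x, 0, by simpa using hx⟩
  have hunique : ∀ x, ∀ S ∈ s.erase F, ∀ T ∈ s.erase F, x ∈ cell S → x ∈ cell T → S = T := by
    rintro x S hS T hT ⟨c, hc⟩ ⟨c', hc'⟩
    have key : ∀ S ∈ s.erase F, ∀ c c' : ℝ,
        (∀ v ∈ V, 0 ≤ φ v (x - c • x₀) ∧ (φ v (x - c • x₀) = 0 ↔ v ∈ S)) →
        (∀ v ∈ V, 0 ≤ φ v (x - c' • x₀)) → c' ≤ c := by
      intro S hS c c' hc hc'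
      have hV := hsV S hS (hv₀S S hS)
      have h0 := (hc _ hV).2.2 (hv₀S S hS)
      have h1 := hc' _ hV
      rw [map_sub, map_smul, smul_eq_mul] at h0 h1
      have : c' * φ (v₀ S) x₀ ≤ c * φ (v₀ S) x₀ := by linarith
      exact le_of_mul_le_mul_right this (hv₀pos S hS)
    have hcc : c = c' := le_antisymm (key T hT c' c hc' fun v hv => (hc v hv).1)
      (key S hS c c' hc fun v hv => (hc' v hv).1)
    subst hcc
    ext v
    constructor
    · intro hv
      have hvV := hsV S hS hv
      exact (hc' v hvV).2.1 ((hc v hvV).2.2 hv)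
    · intro hv
      have hvV := hsV T hT hv
      exact (hc v hvV).2.1 ((hc' v hvV).2.2 hv)
  have hcover : ∀ x ∈ zeroSpace φ F, ∃ S ∈ s.erase F, x ∈ cell S := by
    intro x hx
    rw [mem_zeroSpace] at hx
    obtain ⟨v₁, hv₁, hmin⟩ := Finset.exists_min_image (V \ F) (fun v => φ v x / φ v x₀) hne
    rw [Finset.mem_sdiff] at hv₁
    set c := φ v₁ x / φ v₁ x₀ with hc
    have hface : ∀ v ∈ V, 0 ≤ φ v (x - c • x₀) ∧
        (φ v (x - c • x₀) = 0 ↔ v ∈ ({v ∈ V | φ v (x - c • x₀) = 0} : Finset α)) := by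
      intro v hv
      refine ⟨?_, by simp [hv]⟩
      rw [map_sub, map_smul, smul_eq_mul]
      by_cases hvF : v ∈ F
      · rw [hx v hvF, hzero v hvF]
        simp
      · have := hmin v (Finset.mem_sdiff.2 ⟨hv, hvF⟩)
        rw [le_div_iff₀ (hpos v hv hvF)] at this
        linarith
    refine ⟨{v ∈ V | φ v (x - c • x₀) = 0}, ?_, c, hface⟩
    simp only [hs, Finset.mem_erase, Finset.mem_filter, Finset.mem_powerset]
    refine ⟨fun h => hv₁.2 ?_, Finset.filter_subset _ _, ⟨Finset.filter_subset _ _, _, hface⟩,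
      fun v hv => ?_⟩
    · rw [← h, Finset.mem_filter, map_sub, map_smul, smul_eq_mul, hc,
        div_mul_cancel₀ _ (hpos v₁ hv₁.1 hv₁.2).ne', sub_self]
      exact ⟨hv₁.1, rfl⟩
    · rw [Finset.mem_filter, map_sub, map_smul, hx v hv, hzero v hv]
      exact ⟨hFsub hv, by simp⟩
  have hsub : ∀ S ∈ s.erase F, cell S ⊆ zeroSpace φ F := by
    rintro S hS x ⟨c, hc⟩
    rw [SetLike.mem_coe, mem_zeroSpace]
    intro v hv
    have hvS : v ∈ S := by
      simp only [hs, Finset.mem_erase, Finset.mem_filter] at hS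
      exact hS.2.2.2 hv
    have := (hc v (hFsub hv)).2.2 hvS
    rw [map_sub, map_smul, hzero v hv] at this
    simpa using this
  have hrel := sum_cell_eq_zero (s.erase F).insertNone
    (fun o => o.elim (-1) fun _ => 1)
    (fun o => o.elim (zeroSpace φ F) fun S => (zeroSpace φ S).comap (P S))
    (fun o => o.elim ∅ fun S => V \ S)
    (fun o v => o.elim 0 fun S => φ v ∘ₗ P S)
    (fun o => o.elim (zeroSpace φ F : Set E) cell) ?_ ?_ ?_
  · rw [Finset.sum_insertNone] at hrel
    have hrel' : (-1 : ℤ) * (-1) ^ Module.finrank ℝ (zeroSpace φ F) + ∑ S ∈ s.erase F,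
        (1 : ℤ) * (-1) ^ Module.finrank ℝ ((zeroSpace φ S).comap (P S)) = 0 := hrel
    rw [← Finset.add_sum_erase s _ hFs]
    have h2 : ∑ S ∈ s.erase F, (1 : ℤ) * (-1) ^ Module.finrank ℝ ((zeroSpace φ S).comap (P S)) =
        - ∑ S ∈ s.erase F, (-1 : ℤ) ^ Module.finrank ℝ (zeroSpace φ S) := by
      rw [← Finset.sum_neg_distrib]
      refine Finset.sum_congr rfl fun S hS => ?_
      rw [hdim S hS]
      ring
    rw [h2] at hrel'
    linarith
  · intro o ho x
    cases o with
    | none => simp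
    | some S => exact hcell S (by simpa using ho) x
  · intro o ho
    cases o with
    | none => exact ⟨0, Submodule.zero_mem _⟩
    | some S => exact hcellne S (by simpa using ho)
  · intro x
    rw [Finset.sum_insertNone]
    simp only [Option.elim]
    by_cases hx : x ∈ zeroSpace φ F
    · obtain ⟨S, hS, hxS⟩ := hcover x hx
      rw [Finset.sum_eq_single_of_mem S hS fun T hT hTS =>
        Set.indicator_of_notMem (fun h => hTS (hunique x T hT S hS h hxS)) _,
        Set.indicator_of_mem hxS, Set.indicator_of_mem (by exact hx)]
      simp
    · rw [Set.indicator_of_notMem (by exact hx), Finset.sum_eq_zero fun T hT =>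
        Set.indicator_of_notMem (fun h => hx (hsub T hT h)) _]
      simp

theorem sum_alternating_choose_mul_choose (j D k : ℕ) (hj : j ≤ D) (hk : k ≤ D) :
    ∑ i ∈ Finset.range (j + 1), (-1 : ℤ) ^ i * (j.choose i : ℤ) * ((D - i).choose (D - k) : ℤ) =
      ((D - j).choose k : ℤ) := by
  induction j generalizing D k with
  | zero => simp [Nat.choose_symm hk]
  | succ j ih =>
    obtain ⟨D, rfl⟩ : ∃ D', D = D' + 1 := ⟨D - 1, by omega⟩
    have hsplit : ∑ i ∈ Finset.range (j + 1 + 1), (-1 : ℤ) ^ i * ((j + 1).choose i : ℤ) *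
        ((D + 1 - i).choose (D + 1 - k) : ℤ) =
        ∑ i ∈ Finset.range (j + 1), (-1 : ℤ) ^ i * (j.choose i : ℤ) *
          ((D + 1 - i).choose (D + 1 - k) : ℤ) -
        ∑ i ∈ Finset.range (j + 1), (-1 : ℤ) ^ i * (j.choose i : ℤ) *
          ((D - i).choose (D + 1 - k) : ℤ) := by
      rw [Finset.sum_range_succ', Finset.sum_congr rfl (g := fun i =>
        (-1 : ℤ) ^ (i + 1) * (j.choose (i + 1) : ℤ) * ((D + 1 - (i + 1)).choose (D + 1 - k) : ℤ)
        - (-1 : ℤ) ^ i * (j.choose i : ℤ) * ((D - i).choose (D + 1 - k) : ℤ)) fun i _ => ?_]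
      · rw [Finset.sum_sub_distrib, sub_add_eq_add_sub]
        congr 1
        have := Finset.sum_range_succ' (fun i => (-1 : ℤ) ^ i * (j.choose i : ℤ) *
          ((D + 1 - i).choose (D + 1 - k) : ℤ)) (j + 1)
        rw [Finset.sum_range_succ] at this
        simpa using this.symm
      · rw [Nat.choose_succ_succ, Nat.add_sub_add_right]
        push_cast
        ring
    rw [hsplit, ih _ _ (by omega) hk]
    rcases k with _ | k
    · rw [Finset.sum_eq_zero]
      · simp
      · intro i _
        rw [Nat.choose_eq_zero_of_lt (by omega : D - i < D + 1 - 0)]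
        simp
    · rw [Nat.add_sub_add_right, ih D k (by omega) (by omega), Nat.add_sub_add_right,
        Nat.sub_add_comm (by omega : j ≤ D), Nat.choose_succ_succ]
      push_cast
      ring

/-- Extend the summation in an `h`-vector entry to a larger range. -/
theorem sum_range_choose_eq {D k n : ℕ} (hk : k ≤ D) (hn : k ≤ n) (hnD : n ≤ D) (f : ℕ → ℤ) :
    ∑ i ∈ Finset.range (k + 1), (-1 : ℤ) ^ (k - i) * ((D - i).choose (D - k) : ℤ) * f i =
    (-1) ^ k * ∑ i ∈ Finset.range (n + 1), (-1 : ℤ) ^ i * ((D - i).choose (D - k) : ℤ) * f i := by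
  rw [← Finset.sum_subset (Finset.range_mono (by omega : k + 1 ≤ n + 1)), Finset.mul_sum]
  · refine Finset.sum_congr rfl fun i hi => ?_
    have hik : i ≤ k := by simpa [Nat.lt_succ_iff] using hi
    have : (-1 : ℤ) ^ k = (-1) ^ (k - i) * (-1) ^ i := by rw [← pow_add, Nat.sub_add_cancel hik]
    rw [this, mul_assoc _ ((-1 : ℤ) ^ i), ← mul_assoc ((-1 : ℤ) ^ i), ← mul_assoc ((-1 : ℤ) ^ i),
      ← pow_add, Even.neg_one_pow ⟨i, rfl⟩, one_mul, mul_assoc]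
  · intro i hi hi'
    rw [Finset.mem_range] at hi hi'
    rw [Nat.choose_eq_zero_of_lt (by omega)]
    simp

/-- Dehn–Sommerville equations in `f`-vector form imply their `h`-vector form. -/
theorem hVector_symm (D : ℕ) (f b : ℕ → ℤ)
    (h : ∀ i ≤ D, ∑ j ∈ Finset.range (D + 1), (-1 : ℤ) ^ j * (j.choose i : ℤ) * f j =
      (-1) ^ D * (f i + b i)) (k : ℕ) (hk : k ≤ D) :
    ∑ i ∈ Finset.range (D - k + 1),
        (-1 : ℤ) ^ (D - k - i) * ((D - i).choose (D - (D - k)) : ℤ) * f i =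
      ∑ i ∈ Finset.range (k + 1),
        (-1 : ℤ) ^ (k - i) * ((D - i).choose (D - k) : ℤ) * (f i + b i) := by
  rw [sum_range_choose_eq (n := D) (Nat.sub_le _ _) (Nat.sub_le _ _) le_rfl,
    sum_range_choose_eq hk hk le_rfl, Nat.sub_sub_self hk]
  have h1 : ∀ i ∈ Finset.range (D + 1),
      (-1 : ℤ) ^ i * ((D - i).choose (D - k) : ℤ) * (f i + b i) =
      ∑ j ∈ Finset.range (D + 1), (-1 : ℤ) ^ D * ((-1) ^ j * f j *
        ((-1) ^ i * (j.choose i : ℤ) * ((D - i).choose (D - k) : ℤ))) := by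
    intro i hi
    have hi : i ≤ D := by simpa [Nat.lt_succ_iff] using hi
    have h2 : f i + b i = (-1) ^ D * ((-1) ^ D * (f i + b i)) := by
      rw [← mul_assoc, ← pow_add, Even.neg_one_pow ⟨D, rfl⟩, one_mul]
    rw [h2, ← h i hi, Finset.mul_sum, Finset.mul_sum]
    refine Finset.sum_congr rfl fun j _ => ?_
    ring
  rw [Finset.sum_congr rfl h1, Finset.sum_comm, Finset.mul_sum, Finset.mul_sum]
  refine Finset.sum_congr rfl fun j hj => ?_
  have hj : j ≤ D := by simpa [Nat.lt_succ_iff] using hj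
  rw [← Finset.mul_sum, ← Finset.mul_sum, ← Finset.sum_subset
    (Finset.range_mono (by omega : j + 1 ≤ D + 1)), sum_alternating_choose_mul_choose j D k hj hk]
  · have : (-1 : ℤ) ^ D = (-1) ^ (D - k) * (-1) ^ k := by rw [← pow_add, Nat.sub_add_cancel hk]
    have h3 : (-1 : ℤ) ^ k * (-1) ^ k = 1 := by rw [← pow_add, Even.neg_one_pow ⟨k, rfl⟩]
    rw [this]
    linear_combination (-1 : ℤ) ^ (D - k) * (-1) ^ j * ((D - j).choose k) * f j * (-1) ^ 0 * (-h3)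
  · intro i _ hi
    rw [Finset.mem_range] at hi
    rw [Nat.choose_eq_zero_of_lt (by omega : j < i)]
    simp

/-- The `g`-vector in terms of the `f`-vector. -/
theorem gBd_eq {d : ℕ} (P : Set (Euc d)) (hP : fBdm1 P (d + 1) = 0) {k : ℕ} (hk : k ≤ d + 1) :
    gBd P k = ∑ i ∈ Finset.range (k + 1),
      (-1 : ℤ) ^ (k - i) * ((d + 1 - i).choose (d + 1 - k) : ℤ) * fBdm1 P i := by
  unfold gBd
  rcases k with _ | k
  · simp [hBd]
  rw [if_neg (Nat.succ_ne_zero k), Nat.add_sub_cancel, if_pos (show k ≤ d by omega)]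
  unfold hBd
  rcases Nat.lt_or_ge k d with hkd | hkd
  · rw [if_pos (by omega), Finset.sum_range_succ, Finset.sum_range_succ _ (k + 1),
      add_sub_right_comm, ← Finset.sum_sub_distrib]
    congr 1
    · refine Finset.sum_congr rfl fun i hi => ?_
      have hi : i ≤ k := by simpa [Nat.lt_succ_iff] using hi
      obtain ⟨m, rfl⟩ : ∃ m, d = k + 1 + m := ⟨d - (k + 1), by omega⟩
      rw [show k + 1 + m - (k + 1) = m by omega, show k + 1 + m - k = m + 1 by omega,
        show k + 1 + m + 1 - i = (k + 1 + m - i) + 1 by omega,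
        show k + 1 + m + 1 - (k + 1) = m + 1 by omega, Nat.choose_succ_succ,
        Nat.sub_add_comm hi]
      push_cast
      ring
    · simp
  · obtain rfl : k = d := by omega
    rw [if_neg (by omega), Finset.sum_range_succ _ (k + 1), hP, mul_zero, add_zero, zero_sub,
      ← Finset.sum_neg_distrib]
    refine Finset.sum_congr rfl fun i hi => ?_
    have hi : i ≤ k := by simpa [Nat.lt_succ_iff] using hi
    rw [Nat.sub_add_comm hi]
    simp [pow_succ]

section
variable {α : Type*} [DecidableEq α]

/-- The sets in `Φ` that are proper subsets of `V1 ∪ V2` meeting both of the disjoint sets `V1` and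
`V2`. -/
def mixedFaces (Φ : Finset (Finset α)) (V1 V2 : Finset α) : Finset (Finset α) :=
  {S ∈ Φ | S ≠ V1 ∪ V2 ∧ ¬ S ⊆ V1 ∧ ¬ S ⊆ V2}

theorem sum_mixedFaces_superset {V1 V2 : Finset α} {Φ : Finset (Finset α)} {e : Finset α → ℕ}
    {D : ℕ} (hdisj : Disjoint V1 V2) (hne1 : V1.Nonempty) (hne2 : V2.Nonempty)
    (hempty : ∅ ∈ Φ) (hV : V1 ∪ V2 ∈ Φ)
    (he : ∀ S ∈ Φ, S ≠ V1 → S ≠ V2 → S ≠ V1 ∪ V2 → e S + S.card = D + 1)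
    (heV : e (V1 ∪ V2) = 0)
    (heuler : ∀ F ∈ Φ, F ≠ V1 ∪ V2 → ∑ S ∈ Φ with F ⊆ S, (-1 : ℤ) ^ e S = 0)
    (heuler1 : ∀ F ∈ Φ, F ⊂ V1 → ∑ S ∈ Φ with F ⊆ S ∧ S ⊆ V1, (-1 : ℤ) ^ e S = 0)
    (heuler2 : ∀ F ∈ Φ, F ⊂ V2 → ∑ S ∈ Φ with F ⊆ S ∧ S ⊆ V2, (-1 : ℤ) ^ e S = 0)
    {F : Finset α} (hF : F ∈ Φ) (hF1 : F ≠ V1) (hF2 : F ≠ V2) (hFV : F ⊂ V1 ∪ V2) :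
    ∑ S ∈ mixedFaces Φ V1 V2 with F ⊆ S, (-1 : ℤ) ^ S.card =
      (-1) ^ D + if F = ∅ then 1 else 0 := by
  have hzero : ∀ W : Finset α, F ≠ W →
      (F ⊂ W → ∑ S ∈ Φ with F ⊆ S ∧ S ⊆ W, (-1 : ℤ) ^ e S = 0) →
      ∑ S ∈ Φ with F ⊆ S ∧ S ⊆ W, (-1 : ℤ) ^ e S = 0 := by
    intro W hFW h
    by_cases hs : F ⊆ W
    · exact h (hs.ssubset_of_ne hFW)
    · rw [Finset.filter_false_of_mem fun S _ h => hs (h.1.trans h.2), Finset.sum_empty]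
  have h1 := hzero V1 hF1 (heuler1 F hF)
  have h2 := hzero V2 hF2 (heuler2 F hF)
  have h0 := heuler F hF hFV.ne
  have hcase : ∀ S ∈ Φ, (if F ⊆ S then (-1 : ℤ) ^ e S else 0) =
      (if F ⊆ S ∧ S ⊆ V1 then (-1 : ℤ) ^ e S else 0) +
      (if F ⊆ S ∧ S ⊆ V2 then (-1 : ℤ) ^ e S else 0) -
      (if S = ∅ then if F = ∅ then (-1 : ℤ) ^ e S else 0 else 0) +
      (if S = V1 ∪ V2 then (-1 : ℤ) ^ e S else 0) +
      (if (S ≠ V1 ∪ V2 ∧ ¬ S ⊆ V1 ∧ ¬ S ⊆ V2) ∧ F ⊆ S then (-1 : ℤ) ^ e S else 0) := by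
    intro S _
    by_cases hFS : F ⊆ S
    · by_cases hSV : S = V1 ∪ V2
      · subst hSV
        have hn1 : ¬ V1 ∪ V2 ⊆ V1 := fun h => hne2.ne_empty <| Finset.disjoint_self_iff_empty _ |>.1
          (hdisj.mono_left (Finset.subset_union_right.trans h))
        have hn2 : ¬ V1 ∪ V2 ⊆ V2 := fun h => hne1.ne_empty <| Finset.disjoint_self_iff_empty _ |>.1
          (hdisj.mono_right (Finset.subset_union_left.trans h))
        have hn3 : V1 ∪ V2 ≠ ∅ := (hne1.mono Finset.subset_union_left).ne_empty
        simp [hn1, hn2, hn3, hFS]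
      · by_cases hS0 : S = ∅
        · subst hS0
          have hF0 : F = ∅ := Finset.subset_empty.1 hFS
          rw [if_neg hSV]
          simp [hF0]
        · by_cases hs1 : S ⊆ V1
          · have hs2 : ¬ S ⊆ V2 := fun h => hS0 <| Finset.disjoint_self_iff_empty _ |>.1
              (hdisj.mono hs1 h)
            simp [hSV, hS0, hs1, hs2, hFS]
          · by_cases hs2 : S ⊆ V2 <;> simp [hSV, hS0, hs1, hs2, hFS]
    · have hS0 : S = ∅ → F ≠ ∅ := fun h h' => hFS (by simp [h'])
      have hSV : S ≠ V1 ∪ V2 := fun h => hFS (h ▸ hFV.subset)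
      by_cases hS : S = ∅
      · simp [hFS, hSV, hS0 hS]
      · simp [hFS, hSV, hS]
  have hmixed : ∑ S ∈ Φ, (if (S ≠ V1 ∪ V2 ∧ ¬ S ⊆ V1 ∧ ¬ S ⊆ V2) ∧ F ⊆ S then (-1 : ℤ) ^ e S else 0)
      = (-1) ^ (D + 1) * ∑ S ∈ mixedFaces Φ V1 V2 with F ⊆ S, (-1 : ℤ) ^ S.card := by
    rw [mixedFaces, Finset.filter_filter, ← Finset.sum_filter, Finset.mul_sum]
    refine Finset.sum_congr rfl fun S hS => ?_
    rw [Finset.mem_filter] at hS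
    rw [← he S hS.1 (fun h => hS.2.1.2.1 h.subset) (fun h => hS.2.1.2.2 h.subset) hS.2.1.1,
      pow_add, mul_assoc, ← pow_add, Even.neg_one_pow ⟨_, rfl⟩, mul_one]
  have he0 : e ∅ = D + 1 := by
    have := he ∅ hempty hne1.ne_empty.symm hne2.ne_empty.symm
      (hne1.mono Finset.subset_union_left).ne_empty.symm
    simpa using this
  rw [Finset.sum_filter] at h0 h1 h2
  rw [Finset.sum_congr rfl hcase, Finset.sum_add_distrib, Finset.sum_add_distrib,
    Finset.sum_sub_distrib, Finset.sum_add_distrib, h1, h2, hmixed, Finset.sum_ite_eq',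
    Finset.sum_ite_eq', if_pos hempty, if_pos hV, heV, he0] at h0
  have hD : (-1 : ℤ) ^ D * (-1) ^ D = 1 := by rw [← pow_add, Even.neg_one_pow ⟨D, rfl⟩]
  rw [pow_succ] at h0
  set X := ∑ S ∈ mixedFaces Φ V1 V2 with F ⊆ S, (-1 : ℤ) ^ S.card
  split_ifs at h0 ⊢
  · linear_combination (-(-1 : ℤ) ^ D) * h0 + (1 - X) * hD
  · linear_combination (-(-1 : ℤ) ^ D) * h0 - X * hD

/-- Double counting of the pairs `F ⊆ S` with `S` mixed and `|F| = i`. -/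
theorem sum_card_mixedFaces {V1 V2 : Finset α} {Φ : Finset (Finset α)} {e : Finset α → ℕ}
    {D : ℕ} (hdisj : Disjoint V1 V2) (hne1 : V1.Nonempty) (hne2 : V2.Nonempty)
    (hsub : ∀ S ∈ Φ, S ⊆ V1 ∪ V2)
    (hempty : ∅ ∈ Φ) (hV : V1 ∪ V2 ∈ Φ)
    (hdown : ∀ S ∈ mixedFaces Φ V1 V2, ∀ T ⊆ S, T ∈ Φ ∧ T ≠ V1 ∧ T ≠ V2)
    (he : ∀ S ∈ Φ, S ≠ V1 → S ≠ V2 → S ≠ V1 ∪ V2 → e S + S.card = D + 1)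
    (hpos : ∀ S ∈ Φ, S ≠ V1 ∪ V2 → 1 ≤ e S)
    (heV : e (V1 ∪ V2) = 0)
    (heuler : ∀ F ∈ Φ, F ≠ V1 ∪ V2 → ∑ S ∈ Φ with F ⊆ S, (-1 : ℤ) ^ e S = 0)
    (heuler1 : ∀ F ∈ Φ, F ⊂ V1 → ∑ S ∈ Φ with F ⊆ S ∧ S ⊆ V1, (-1 : ℤ) ^ e S = 0)
    (heuler2 : ∀ F ∈ Φ, F ⊂ V2 → ∑ S ∈ Φ with F ⊆ S ∧ S ⊆ V2, (-1 : ℤ) ^ e S = 0) (i : ℕ) :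
    ∑ j ∈ Finset.range (D + 1), (-1 : ℤ) ^ j * (j.choose i : ℤ) *
        ((({S ∈ mixedFaces Φ V1 V2 | S.card = j} : Finset _).card : ℤ) - if j = 0 then 1 else 0) =
      (-1) ^ D * (((({S ∈ mixedFaces Φ V1 V2 | S.card = i} : Finset _).card : ℤ) -
          if i = 0 then 1 else 0) +
        ((({S ∈ Φ | S ⊂ V1 ∧ S.card = i} : Finset _).card : ℤ) +
          (({S ∈ Φ | S ⊂ V2 ∧ S.card = i} : Finset _).card : ℤ))) := by
  set 𝓕 := mixedFaces Φ V1 V2 with h𝓕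
  have hmem : ∀ S, S ∈ 𝓕 ↔ S ∈ Φ ∧ S ≠ V1 ∪ V2 ∧ ¬ S ⊆ V1 ∧ ¬ S ⊆ V2 := fun S => by
    rw [h𝓕, mixedFaces, Finset.mem_filter]
  have hVsub : ∀ W : Finset α, W ⊆ V1 → W ⊂ V1 ∪ V2 := fun W hW =>
    ⟨hW.trans Finset.subset_union_left, fun h => hne2.ne_empty <|
      Finset.disjoint_self_iff_empty _ |>.1 (hdisj.mono_left
        ((Finset.subset_union_right.trans h).trans hW))⟩
  have hVsub' : ∀ W : Finset α, W ⊆ V2 → W ⊂ V1 ∪ V2 := fun W hW =>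
    ⟨hW.trans Finset.subset_union_right, fun h => hne1.ne_empty <|
      Finset.disjoint_self_iff_empty _ |>.1 (hdisj.mono_right
        ((Finset.subset_union_left.trans h).trans hW))⟩
  set Ψ : Finset (Finset α) := {S ∈ Φ | (S ≠ V1 ∧ S ≠ V2 ∧ S ≠ V1 ∪ V2) ∧ S.card = i} with hΨ
  have hcardle : ∀ S ∈ 𝓕, S.card ≤ D := by
    intro S hS
    rw [hmem] at hS
    have h1 := he S hS.1 (fun h => hS.2.2.1 h.subset) (fun h => hS.2.2.2 h.subset) hS.2.1
    have h2 := hpos S hS.1 hS.2.1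
    omega
  have hleft : ∑ j ∈ Finset.range (D + 1), (-1 : ℤ) ^ j * (j.choose i : ℤ) *
      (({S ∈ 𝓕 | S.card = j} : Finset _).card : ℤ) =
      ∑ S ∈ 𝓕, (-1 : ℤ) ^ S.card * (S.card.choose i : ℤ) := by
    rw [← Finset.sum_fiberwise_of_maps_to (t := Finset.range (D + 1)) (g := Finset.card)
      fun S hS => Finset.mem_range.2 (Nat.lt_succ_of_le (hcardle S hS))]
    refine Finset.sum_congr rfl fun j _ => ?_
    rw [Finset.sum_congr rfl (g := fun _ => (-1 : ℤ) ^ j * (j.choose i : ℤ)) fun S hS => by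
      rw [(Finset.mem_filter.1 hS).2], Finset.sum_const, nsmul_eq_mul, mul_comm]
  have hswap : ∑ S ∈ 𝓕, (-1 : ℤ) ^ S.card * (S.card.choose i : ℤ) =
      ∑ F ∈ Ψ, ∑ S ∈ 𝓕 with F ⊆ S, (-1 : ℤ) ^ S.card := by
    have : ∀ S ∈ 𝓕, (-1 : ℤ) ^ S.card * (S.card.choose i : ℤ) =
        ∑ F ∈ Ψ with F ⊆ S, (-1 : ℤ) ^ S.card := by
      intro S hS
      rw [Finset.sum_const, nsmul_eq_mul, mul_comm, ← Finset.card_powersetCard]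
      congr 3
      ext T
      rw [Finset.mem_powersetCard, Finset.mem_filter, hΨ, Finset.mem_filter]
      constructor
      · rintro ⟨h1, h2⟩
        obtain ⟨h3, h4, h5⟩ := hdown S hS T h1
        rw [hmem] at hS
        exact ⟨⟨h3, ⟨h4, h5, fun h => hS.2.1
          (Finset.Subset.antisymm (hsub S hS.1) (h ▸ h1))⟩, h2⟩, h1⟩
      · rintro ⟨⟨-, -, h2⟩, h1⟩
        exact ⟨h1, h2⟩
    rw [Finset.sum_congr rfl this]
    simp only [Finset.sum_filter]
    exact Finset.sum_comm
  have hcount : (Ψ.card : ℤ) + (if i = 0 then 1 else 0) =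
      (({S ∈ 𝓕 | S.card = i} : Finset _).card : ℤ) +
      ((({S ∈ Φ | S ⊂ V1 ∧ S.card = i} : Finset _).card : ℤ) +
          (({S ∈ Φ | S ⊂ V2 ∧ S.card = i} : Finset _).card : ℤ)) := by
    have h1 : (if i = 0 then (1 : ℤ) else 0) =
        ∑ S ∈ Φ, if S = ∅ then (if S.card = i then 1 else 0) else 0 := by
      rw [Finset.sum_ite_eq', if_pos hempty, Finset.card_empty]
      simp [eq_comm]
    rw [h1, hΨ, h𝓕, mixedFaces, Finset.filter_filter]
    simp only [Finset.card_filter, Nat.cast_sum, ← Finset.sum_add_distrib]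
    refine Finset.sum_congr rfl fun S hS => ?_
    by_cases hi : S.card = i
    · simp only [hi, and_true, if_true]
      by_cases hSV : S = V1 ∪ V2
      · have h2 : ¬ S ⊂ V1 := fun h => (hVsub S h.subset).ne hSV
        have h3 : ¬ S ⊂ V2 := fun h => (hVsub' S h.subset).ne hSV
        have h4 : S ≠ ∅ := by
          rw [hSV]
          exact (hne1.mono Finset.subset_union_left).ne_empty
        have h5 : ¬ S ≠ V1 ∪ V2 := not_not.2 hSV
        simp only [h2, h3, h4, h5, and_false, false_and, if_false, Nat.cast_zero, add_zero]
      by_cases hS0 : S = ∅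
      · subst hS0
        have h2 : ∅ ⊂ V1 := Finset.empty_ssubset.2 hne1
        have h3 : ∅ ⊂ V2 := Finset.empty_ssubset.2 hne2
        simp [h2, h3, h2.ne, h3.ne, hSV]
      by_cases hs1 : S ⊆ V1
      · have hs2 : ¬ S ⊆ V2 := fun h => hS0 <| Finset.disjoint_self_iff_empty _ |>.1
          (hdisj.mono hs1 h)
        have h2 : ¬ S ⊂ V2 := fun h => hs2 h.subset
        have h3 : S ≠ V2 := fun h => hs2 h.subset
        by_cases h4 : S = V1
        · have h5 : ¬ S ⊂ V1 := fun h => h.ne h4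
          have h6 : ¬ S ≠ V1 := not_not.2 h4
          simp only [hS0, hs1, h2, h5, h6, not_true, and_false, false_and, if_false,
            Nat.cast_zero, add_zero]
        · simp [hSV, hS0, hs1, h2, h3, h4, hs1.ssubset_of_ne h4]
      · have h2 : ¬ S ⊂ V1 := fun h => hs1 h.subset
        have h3 : S ≠ V1 := fun h => hs1 h.subset
        by_cases hs2 : S ⊆ V2
        · by_cases h4 : S = V2
          · have h5 : ¬ S ⊂ V2 := fun h => h.ne h4
            have h6 : ¬ S ≠ V2 := not_not.2 h4
            simp only [hS0, hs2, h2, h5, h6, not_true, and_false, false_and, if_false,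
              Nat.cast_zero, add_zero]
          · simp [hSV, hS0, hs1, hs2, h2, h3, h4, hs2.ssubset_of_ne h4]
        · have h4 : ¬ S ⊂ V2 := fun h => hs2 h.subset
          have h5 : S ≠ V2 := fun h => hs2 h.subset
          simp [hSV, hS0, hs1, hs2, h2, h3, h4, h5]
    · simp [hi]
  rw [Finset.sum_congr rfl fun j _ => mul_sub _ _ _, Finset.sum_sub_distrib, hleft, hswap]
  have h3 : ∀ F ∈ Ψ, ∑ S ∈ 𝓕 with F ⊆ S, (-1 : ℤ) ^ S.card =
      (-1) ^ D + if F = ∅ then 1 else 0 := by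
    intro F hF
    rw [hΨ, Finset.mem_filter] at hF
    exact sum_mixedFaces_superset hdisj hne1 hne2 hempty hV he heV heuler heuler1 heuler2 hF.1
      hF.2.1.1 hF.2.1.2.1 ((hsub F hF.1).ssubset_of_ne hF.2.1.2.2)
  have h4 : ∑ F ∈ Ψ, (if F = ∅ then (1 : ℤ) else 0) = if i = 0 then 1 else 0 := by
    rw [Finset.sum_ite_eq']
    refine if_congr ?_ rfl rfl
    rw [hΨ, Finset.mem_filter]
    constructor
    · rintro ⟨-, -, h⟩
      simpa using h.symm
    · rintro rfl
      exact ⟨hempty, ⟨hne1.ne_empty.symm, hne2.ne_empty.symm,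
        (hne1.mono Finset.subset_union_left).ne_empty.symm⟩, rfl⟩
  have h5 : ∑ j ∈ Finset.range (D + 1), (-1 : ℤ) ^ j * (j.choose i : ℤ) *
      (if j = 0 then 1 else 0) = if i = 0 then 1 else 0 := by
    rw [Finset.sum_eq_single 0 (by intro j _ hj; simp [hj]) (by simp)]
    rcases i with _ | i <;> simp
  rw [Finset.sum_congr rfl h3, Finset.sum_add_distrib, h4, h5, Finset.sum_const, nsmul_eq_mul]
  linear_combination (-1 : ℤ) ^ D * hcount

end

section FaceSet
variable {E α : Type*} [AddCommGroup E] [Module ℝ E] {φ : α → E →ₗ[ℝ] ℝ} {V W S T : Finset α}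

theorem IsFaceSet.mono (h : IsFaceSet φ V S) (hSW : S ⊆ W) (hWV : W ⊆ V) : IsFaceSet φ W S :=
  ⟨hSW, h.2.imp fun _ hx v hv => hx v (hWV hv)⟩

theorem isFaceSet_self : IsFaceSet φ V V :=
  ⟨subset_rfl, 0, fun v hv => by simp [hv]⟩

/-- A face of a face is a face. -/
theorem IsFaceSet.trans (hW : IsFaceSet φ V W) (hS : IsFaceSet φ W S) : IsFaceSet φ V S := by
  classical
  obtain ⟨hWV, w, hw⟩ := hW
  obtain ⟨hSW, x, hx⟩ := hS
  have hev : ∀ᶠ M : ℝ in Filter.atTop, ∀ v ∈ V \ W, 0 < φ v x + M * φ v w := by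
    rw [Filter.eventually_all_finset]
    intro v hv
    rw [Finset.mem_sdiff] at hv
    have hpos : 0 < φ v w :=
      lt_of_le_of_ne (hw v hv.1).1 fun h => hv.2 ((hw v hv.1).2.1 h.symm)
    exact (Filter.tendsto_atTop_add_const_left _ _
      (Filter.tendsto_id.atTop_mul_const hpos)).eventually_gt_atTop 0
  obtain ⟨M, hM⟩ := hev.exists
  refine ⟨hSW.trans hWV, x + M • w, fun v hv => ?_⟩
  rw [map_add, map_smul, smul_eq_mul]
  by_cases hvW : v ∈ W
  · rw [(hw v hv).2.2 hvW, mul_zero, add_zero]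
    exact hx v hvW
  · have := hM v (Finset.mem_sdiff.2 ⟨hv, hvW⟩)
    exact ⟨this.le, fun h => absurd h this.ne', fun h => absurd (hSW h) hvW⟩

theorem IsFaceSet.finrank_zeroSpace_lt [FiniteDimensional ℝ E] (hS : IsFaceSet φ V S)
    (hST : S ⊂ T) (hTV : T ⊆ V) :
    Module.finrank ℝ (zeroSpace φ T) < Module.finrank ℝ (zeroSpace φ S) := by
  obtain ⟨-, x, hx⟩ := hS
  obtain ⟨v, hvT, hvS⟩ := Finset.exists_of_ssubset hST
  refine Submodule.finrank_lt_finrank_of_lt (SetLike.lt_iff_le_and_exists.2 ⟨fun y hy => ?_, x,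
    ?_, fun h => hvS ((hx v (hTV hvT)).2.1 (mem_zeroSpace.1 h v hvT))⟩)
  · rw [mem_zeroSpace] at hy ⊢
    exact fun v hv => hy v (hST.subset hv)
  · rw [mem_zeroSpace]
    exact fun v hv => (hx v (hTV (hST.subset hv))).2.2 hv

end FaceSet

/-- Evaluation of affine functions at a point. -/
def evalAff {n : ℕ} (v : Euc n) : (Euc n →ᵃ[ℝ] ℝ) →ₗ[ℝ] ℝ where
  toFun a := a v
  map_add' _ _ := rfl
  map_smul' _ _ := rfl

@[simp]
theorem evalAff_apply {n : ℕ} (v : Euc n) (a : Euc n →ᵃ[ℝ] ℝ) : evalAff v a = a v := rfl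

theorem setDim_convexHull {n : ℕ} (S : Set (Euc n)) :
    setDim (convexHull ℝ S) = Module.finrank ℝ (vectorSpan ℝ S) := by
  rw [setDim, affineSpan_convexHull, direction_affineSpan]

theorem finrank_zeroSpace_empty {n : ℕ} :
    Module.finrank ℝ (zeroSpace (evalAff (n := n)) ∅) = n + 1 := by
  have : zeroSpace (evalAff (n := n)) ∅ = ⊤ := by simp [zeroSpace]
  rw [this, finrank_top, (AffineMap.toConstProdLinearMap ℝ).finrank_eq, Module.finrank_prod,
    Module.finrank_self, Module.finrank_linearMap]
  simp [add_comm]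

/-- The affine functions vanishing on `S` have dimension complementary to `S`. -/
theorem finrank_zeroSpace_add_setDim {n : ℕ} {S : Finset (Euc n)} (hS : S.Nonempty) :
    Module.finrank ℝ (zeroSpace evalAff S) + setDim (convexHull ℝ (S : Set (Euc n))) = n := by
  obtain ⟨p, hp⟩ := hS
  let f : zeroSpace (evalAff (n := n)) S →ₗ[ℝ] Module.Dual ℝ (Euc n) :=
    (LinearMap.snd ℝ ℝ _ ∘ₗ (AffineMap.toConstProdLinearMap ℝ).toLinearMap).domRestrict _
  have hf : ∀ a, f a = a.1.linear := fun a => rfl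
  have hvan : ∀ a : zeroSpace (evalAff (n := n)) S, ∀ v ∈ S, a.1 v = 0 :=
    fun a => mem_zeroSpace.1 a.2
  have hinj : Function.Injective f := by
    rw [← LinearMap.ker_eq_bot, LinearMap.ker_eq_bot']
    intro a ha
    ext x
    have := a.1.linearMap_vsub x p
    rw [← hf, ha, hvan a p hp] at this
    simpa using this.symm
  have hrange : LinearMap.range f = (vectorSpan ℝ (S : Set (Euc n))).dualAnnihilator := by
    ext l
    rw [Submodule.mem_dualAnnihilator, LinearMap.mem_range]
    constructor
    · rintro ⟨a, rfl⟩
      have : vectorSpan ℝ (S : Set (Euc n)) ≤ LinearMap.ker (f a) := by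
        rw [vectorSpan_def, Submodule.span_le]
        rintro _ ⟨x, hx, y, hy, rfl⟩
        rw [SetLike.mem_coe, LinearMap.mem_ker, hf]
        change a.1.linear (x -ᵥ y) = 0
        rw [AffineMap.linearMap_vsub, hvan a x hx, hvan a y hy, vsub_self]
      exact fun w hw => this hw
    · intro hl
      refine ⟨⟨l.toAffineMap - AffineMap.const ℝ _ (l p), mem_zeroSpace.2 fun v hv => ?_⟩, ?_⟩
      · have := hl _ (vsub_mem_vectorSpan ℝ (Finset.mem_coe.2 hv) (Finset.mem_coe.2 hp))
        simpa using this
      · rw [hf]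
        ext x
        simp
  have h1 := LinearMap.finrank_range_of_inj hinj
  have h2 := Subspace.finrank_add_finrank_dualAnnihilator_eq (vectorSpan ℝ (S : Set (Euc n)))
  rw [← hrange, h1, Module.finrank_fin_fun] at h2
  rw [setDim_convexHull]
  omega

theorem AffineIndependent.setDim_convexHull {n : ℕ} {S : Finset (Euc n)} (hne : S.Nonempty)
    (hS : AffineIndependent ℝ (fun v : {x // x ∈ S} => (v : Euc n))) :
    setDim (convexHull ℝ (S : Set (Euc n))) + 1 = S.card := by
  obtain ⟨m, hm⟩ : ∃ m, S.card = m + 1 := ⟨S.card - 1, by have := hne.card_pos; omega⟩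
  have h1 := hS.finrank_vectorSpan (n := m) (by simpa using hm)
  have h2 : Set.range (fun v : {x // x ∈ S} => (v : Euc n)) = S := by simp
  rw [h2] at h1
  rw [_root_.setDim_convexHull, h1, hm]

theorem AffineIndependent.finrank_zeroSpace_add_card {n : ℕ} {S : Finset (Euc n)}
    (hS : AffineIndependent ℝ (fun v : {x // x ∈ S} => (v : Euc n))) :
    Module.finrank ℝ (zeroSpace evalAff S) + S.card = n + 1 := by
  rcases S.eq_empty_or_nonempty with rfl | hne
  · rw [finrank_zeroSpace_empty, Finset.card_empty]
  · rw [← hS.setDim_convexHull hne, ← add_assoc, finrank_zeroSpace_add_setDim hne]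

/-- Subsets of an affinely independent set are its faces. -/
theorem AffineIndependent.isFaceSet {n : ℕ} {S T : Finset (Euc n)}
    (hS : AffineIndependent ℝ (fun v : {x // x ∈ S} => (v : Euc n))) (hT : T ⊆ S) :
    IsFaceSet evalAff S T := by
  classical
  obtain ⟨t, hSt, ht, htop⟩ := exists_subset_affineIndependent_affineSpan_eq_top
    (s := (S : Set (Euc n))) hS
  let b : AffineBasis t ℝ (Euc n) := ⟨fun p => p, ht, by simpa using htop⟩
  refine ⟨hT, ∑ w ∈ (S \ T).subtype (· ∈ t), b.coord w, fun v hv => ?_⟩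
  have h1 : evalAff v (∑ w ∈ (S \ T).subtype (· ∈ t), b.coord w) = if v ∈ T then 0 else 1 := by
    have hb : b ⟨v, hSt hv⟩ = v := rfl
    rw [map_sum]
    have h2 : ∀ w : t, evalAff v (b.coord w) = if w = ⟨v, hSt hv⟩ then 1 else 0 := fun w => by
      rw [evalAff_apply]
      conv_lhs => rw [← hb]
      rw [b.coord_apply]
    rw [Finset.sum_congr rfl fun w _ => h2 w, Finset.sum_ite_eq']
    simp [hv]
  rw [h1]
  by_cases hvT : v ∈ T <;> simp [hvT]

theorem affine_nonneg_of_mem_convexHull {n : ℕ} {V : Set (Euc n)} {a : Euc n →ᵃ[ℝ] ℝ}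
    (ha : ∀ v ∈ V, 0 ≤ a v) {x : Euc n} (hx : x ∈ convexHull ℝ V) : 0 ≤ a x := by
  have : convexHull ℝ V ⊆ a ⁻¹' Ici 0 :=
    convexHull_min (fun v hv => ha v hv) ((convex_Ici 0).affine_preimage a)
  exact this hx

theorem affine_eq_zero_of_mem_convexHull {n : ℕ} {V : Set (Euc n)} {a : Euc n →ᵃ[ℝ] ℝ}
    (ha : ∀ v ∈ V, a v = 0) {x : Euc n} (hx : x ∈ convexHull ℝ V) : a x = 0 := by
  have : convexHull ℝ V ⊆ a ⁻¹' {0} :=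
    convexHull_min (fun v hv => ha v hv) ((convex_singleton 0).affine_preimage a)
  exact this hx

theorem mem_convexHull_of_affine_eq_zero {n : ℕ} {V S : Finset (Euc n)} {a : Euc n →ᵃ[ℝ] ℝ}
    (ha : ∀ v ∈ V, 0 ≤ a v ∧ (a v = 0 ↔ v ∈ S)) {x : Euc n}
    (hx : x ∈ convexHull ℝ (V : Set (Euc n))) (hax : a x = 0) :
    x ∈ convexHull ℝ (S : Set (Euc n)) := by
  classical
  obtain ⟨w, hw0, hw1, hwx⟩ := Finset.mem_convexHull'.1 hx
  have hsum : ∑ v ∈ V, w v * a v = 0 := by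
    have h1 : ∀ y, a y = a.linear y + a 0 := fun y => congrFun a.decomp y
    rw [← hax, ← hwx, h1, map_sum]
    conv_rhs => rw [← one_mul (a 0), ← hw1, Finset.sum_mul, ← Finset.sum_add_distrib]
    refine Finset.sum_congr rfl fun v _ => ?_
    rw [map_smul, smul_eq_mul, h1 v, mul_add]
  rw [Finset.sum_eq_zero_iff_of_nonneg fun v hv => mul_nonneg (hw0 v hv) (ha v hv).1] at hsum
  have hw : ∀ v ∈ V, v ∉ S → w v = 0 := fun v hv hvS =>
    (mul_eq_zero.1 (hsum v hv)).resolve_right fun h => hvS ((ha v hv).2.1 h)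
  have hmono : convexHull ℝ ((V ∩ S : Finset (Euc n)) : Set (Euc n)) ⊆
      convexHull ℝ (S : Set (Euc n)) :=
    convexHull_mono (Finset.coe_subset.2 Finset.inter_subset_right)
  refine hmono (Finset.mem_convexHull'.2 ⟨w, fun v hv => hw0 v (Finset.mem_inter.1 hv).1, ?_, ?_⟩)
  · rw [← hw1]
    exact Finset.sum_subset Finset.inter_subset_left fun v hv hv' =>
      hw v hv fun h => hv' (Finset.mem_inter.2 ⟨hv, h⟩)
  · rw [← hwx]
    exact Finset.sum_subset Finset.inter_subset_left fun v hv hv' => by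
      rw [hw v hv fun h => hv' (Finset.mem_inter.2 ⟨hv, h⟩), zero_smul]

theorem IsFaceSet.mem_of_mem_convexHull {n : ℕ} {V S : Finset (Euc n)}
    (hS : IsFaceSet evalAff V S) {v : Euc n} (hv : v ∈ V)
    (hvS : v ∈ convexHull ℝ (S : Set (Euc n))) : v ∈ S := by
  obtain ⟨hSV, a, ha⟩ := hS
  exact (ha v hv).2.1 (affine_eq_zero_of_mem_convexHull
    (fun w hw => (ha w (hSV hw)).2.2 hw) hvS)

theorem IsFaceSet.subset_of_convexHull_subset {n : ℕ} {V S T : Finset (Euc n)} (hTV : T ⊆ V)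
    (hS : IsFaceSet evalAff V S)
    (h : convexHull ℝ (T : Set (Euc n)) ⊆ convexHull ℝ (S : Set (Euc n))) : T ⊆ S :=
  fun _ hv => hS.mem_of_mem_convexHull (hTV hv) (h (subset_convexHull ℝ _ hv))

/-- Proper faces of a polytope are the convex hulls of the proper nonempty faces of its vertex
configuration. -/
theorem isProperFaceOf_convexHull_iff {n : ℕ} {V : Finset (Euc n)} {G : Set (Euc n)} :
    IsProperFaceOf (convexHull ℝ (V : Set (Euc n))) G ↔
      ∃ S : Finset (Euc n), IsFaceSet evalAff V S ∧ S.Nonempty ∧ S ≠ V ∧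
        G = convexHull ℝ (S : Set (Euc n)) := by
  classical
  constructor
  · rintro ⟨hexp, hne, hG⟩
    obtain ⟨l, hl⟩ := hexp hG
    obtain ⟨g, hg⟩ := hG
    have hg' := hg
    rw [hl] at hg'
    let a : Euc n →ᵃ[ℝ] ℝ := AffineMap.const ℝ _ (l g) - (l : Euc n →ₗ[ℝ] ℝ).toAffineMap
    have haa : ∀ x, a x = l g - l x := fun x => rfl
    have hface : IsFaceSet evalAff V {v ∈ V | a v = 0} := by
      refine ⟨Finset.filter_subset _ _, a, fun v hv => ⟨?_, ?_⟩⟩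
      · rw [evalAff_apply, haa, sub_nonneg]
        exact hg'.2 v (subset_convexHull ℝ _ hv)
      · rw [evalAff_apply, Finset.mem_filter, and_iff_right hv]
    have hGS : G = convexHull ℝ (({v ∈ V | a v = 0} : Finset (Euc n)) : Set (Euc n)) := by
      apply Subset.antisymm
      · intro x hx
        have hx' := hx
        rw [hl] at hx'
        refine mem_convexHull_of_affine_eq_zero (V := V) (a := a) (fun v hv => ⟨?_, ?_⟩) hx'.1 ?_
        · rw [haa, sub_nonneg]
          exact hg'.2 v (subset_convexHull ℝ _ hv)
        · rw [Finset.mem_filter, and_iff_right hv]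
        · rw [haa, sub_eq_zero]
          exact le_antisymm (hx'.2 g hg'.1) (hg'.2 x hx'.1)
      · intro x hx
        have hxa : a x = 0 := affine_eq_zero_of_mem_convexHull
          (fun v hv => (Finset.mem_filter.1 (Finset.mem_coe.1 hv)).2) hx
        rw [hl]
        refine ⟨convexHull_mono (Finset.coe_subset.2 (Finset.filter_subset _ _)) hx,
          fun y hy => ?_⟩
        rw [haa, sub_eq_zero] at hxa
        rw [← hxa]
        exact hg'.2 y hy
    refine ⟨_, hface, ?_, ?_, hGS⟩
    · rw [Finset.nonempty_iff_ne_empty]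
      intro h
      rw [hGS, h] at hg
      simp at hg
    · intro h
      rw [h] at hGS
      exact hne hGS
  · rintro ⟨S, hS, hSne, hSV, rfl⟩
    refine ⟨fun _ => ?_, fun h => hSV (Finset.Subset.antisymm hS.1
      (hS.subset_of_convexHull_subset subset_rfl h.ge)), ?_⟩
    · obtain ⟨hSsub, a, ha⟩ := hS
      obtain ⟨p, hp⟩ := hSne
      have h1 : ∀ y, a y = a.linear y + a 0 := fun y => congrFun a.decomp y
      refine ⟨-(LinearMap.toContinuousLinearMap a.linear), ?_⟩
      have hzero : ∀ x ∈ convexHull ℝ (S : Set (Euc n)), a x = 0 := fun x hx =>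
        affine_eq_zero_of_mem_convexHull (fun v hv => (ha v (hSsub hv)).2.2 hv) hx
      have hnn : ∀ x ∈ convexHull ℝ (V : Set (Euc n)), 0 ≤ a x := fun x hx =>
        affine_nonneg_of_mem_convexHull (fun v hv => (ha v hv).1) hx
      ext x
      constructor
      · intro hx
        refine ⟨convexHull_mono (Finset.coe_subset.2 hSsub) hx, fun y hy => ?_⟩
        have h2 := hzero x hx
        have h3 := hnn y hy
        rw [h1] at h2 h3
        simp only [neg_apply, LinearMap.coe_toContinuousLinearMap']
        linarith
      · rintro ⟨hx, hy⟩
        refine mem_convexHull_of_affine_eq_zero ha hx (le_antisymm ?_ (hnn x hx))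
        have h2 := hy p (subset_convexHull ℝ _ (Finset.mem_coe.2 (hSsub hp)))
        have h3 := hzero p (subset_convexHull ℝ _ (Finset.mem_coe.2 hp))
        rw [h1] at h3 ⊢
        simp only [neg_apply, LinearMap.coe_toContinuousLinearMap'] at h2
        linarith
    · exact (Finset.coe_nonempty.2 hSne).convexHull

section Vertices

variable {n : ℕ} {V S : Finset (Euc n)}

theorem IsPolytope.exists_finset {P : Set (Euc n)} (hP : IsPolytope P) :
    ∃ V : Finset (Euc n), (V : Set (Euc n)) = vertSet P ∧
      convexHull ℝ (V : Set (Euc n)) = P := by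
  obtain ⟨T, hT, rfl⟩ := hP
  have hfin : (vertSet (convexHull ℝ T)).Finite := hT.subset extremePoints_convexHull_subset
  refine ⟨hfin.toFinset, hfin.coe_toFinset, ?_⟩
  rw [hfin.coe_toFinset]
  have h := closure_convexHull_extremePoints (hT.isCompact_convexHull ℝ) (convex_convexHull ℝ T)
  exact (hfin.isClosed_convexHull ℝ).closure_eq.symm.trans h

theorem vertSet_convexHull_of_subset (hV : (V : Set (Euc n)) ⊆ vertSet (convexHull ℝ V))
    (hS : S ⊆ V) : vertSet (convexHull ℝ (S : Set (Euc n))) = S := by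
  refine Subset.antisymm extremePoints_convexHull_subset fun v hv => ?_
  exact inter_extremePoints_subset_extremePoints_of_subset
    (convexHull_mono (Finset.coe_subset.2 hS))
    ⟨subset_convexHull ℝ _ hv, hV (Finset.coe_subset.2 hS hv)⟩

theorem convexHull_injOn_powerset (hV : (V : Set (Euc n)) ⊆ vertSet (convexHull ℝ V)) :
    InjOn (fun S : Finset (Euc n) => convexHull ℝ (S : Set (Euc n))) {S | S ⊆ V} :=
  fun S hS T hT h => Finset.coe_injective <| by
    rw [← vertSet_convexHull_of_subset hV hS, ← vertSet_convexHull_of_subset hV hT]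
    exact congrArg vertSet h

theorem IsSimplexSet.affineIndependent
    (hV : (V : Set (Euc n)) ⊆ vertSet (convexHull ℝ V)) (hS : S ⊆ V)
    (h : IsSimplexSet (convexHull ℝ (S : Set (Euc n)))) :
    AffineIndependent ℝ (fun v : {x // x ∈ S} => (v : Euc n)) := by
  obtain ⟨T, hT, hST⟩ := h
  have hsub : (S : Set (Euc n)) ⊆ T := by
    rw [← vertSet_convexHull_of_subset hV hS, hST]
    exact extremePoints_convexHull_subset
  exact AffineIndependent.mono hT hsub

open Classical in
/-- The faces of a simplicial polytope, counted through their vertex sets. -/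
theorem IsSimplicialPolytope.faceCount_eq
    (hV : (V : Set (Euc n)) ⊆ vertSet (convexHull ℝ V))
    (h : IsSimplicialPolytope (convexHull ℝ (V : Set (Euc n)))) (k : ℕ) :
    faceCount (convexHull ℝ (V : Set (Euc n))) k =
      ({S ∈ V.powerset | IsFaceSet evalAff V S ∧ S ≠ V ∧ S.card = k + 1} : Finset _).card := by
  have hdim : ∀ S : Finset (Euc n), IsFaceSet evalAff V S → S.Nonempty → S ≠ V →
      setDim (convexHull ℝ (S : Set (Euc n))) + 1 = S.card := fun S hS hne hSV =>
    ((h.2 _ (isProperFaceOf_convexHull_iff.2 ⟨S, hS, hne, hSV, rfl⟩)).affineIndependent hV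
      hS.1).setDim_convexHull hne
  rw [faceCount, ← Set.ncard_coe_finset,
    ← ((convexHull_injOn_powerset hV).mono fun S hS => ?_).ncard_image]
  · congr 1
    ext F
    simp only [Set.mem_ofPred_eq, Set.mem_image, Finset.mem_coe, Finset.mem_filter,
      Finset.mem_powerset, isProperFaceOf_convexHull_iff]
    constructor
    · rintro ⟨⟨S, hS, hne, hSV, rfl⟩, hk⟩
      exact ⟨S, ⟨hS.1, hS, hSV, by rw [← hdim S hS hne hSV, hk]⟩, rfl⟩
    · rintro ⟨S, ⟨-, hS, hSV, hk⟩, rfl⟩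
      have hne : S.Nonempty := Finset.card_pos.1 (by omega)
      have := hdim S hS hne hSV
      exact ⟨⟨S, hS, hne, hSV, rfl⟩, by omega⟩
  · exact Finset.mem_powerset.1 (Finset.mem_filter.1 hS).1

end Vertices

section Lift

variable {d : ℕ}

/-- The embedding of `E^d` at height `c`, as an affine map. -/
def liftAff (d : ℕ) (c : ℝ) : Euc d →ᵃ[ℝ] Euc (d + 1) where
  toFun := lift c
  linear :=
    { toFun := fun x => Fin.snoc x 0
      map_add' := fun x y => by
        ext i
        refine Fin.lastCases ?_ (fun j => ?_) i <;> simp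
      map_smul' := fun r x => by
        ext i
        refine Fin.lastCases ?_ (fun j => ?_) i <;> simp }
  map_vadd' p v := by
    ext i
    refine Fin.lastCases ?_ (fun j => ?_) i <;> simp [lift]

@[simp]
theorem coe_liftAff (c : ℝ) : ⇑(liftAff d c) = lift c := rfl

@[simp]
theorem lift_last (c : ℝ) (x : Euc d) : lift c x (Fin.last d) = c := by simp [lift]

/-- The projection of `E^{d+1}` along the last coordinate. -/
def dropLast (d : ℕ) : Euc (d + 1) →ₗ[ℝ] Euc d := LinearMap.funLeft ℝ ℝ Fin.castSucc

@[simp]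
theorem dropLast_lift (c : ℝ) (x : Euc d) : dropLast d (lift c x) = x := by
  ext i
  simp [dropLast, lift]

theorem lift_injective (c : ℝ) : Function.Injective (lift c : Euc d → Euc (d + 1)) :=
  Function.LeftInverse.injective (dropLast_lift c)

theorem setDim_image_lift (c : ℝ) (P : Set (Euc d)) : setDim (lift c '' P) = setDim P := by
  have hinj : Function.Injective (liftAff d c).linear :=
    (liftAff d c).linear_injective_iff.2 (lift_injective c)
  rw [setDim, ← coe_liftAff, ← AffineSubspace.map_span, AffineSubspace.map_direction]
  exact ((affineSpan ℝ P).direction.equivMapOfInjective _ hinj).finrank_eq.symm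

theorem image_lift_convexHull (c : ℝ) (S : Set (Euc d)) :
    lift c '' convexHull ℝ S = convexHull ℝ (lift c '' S) :=
  (liftAff d c).image_convexHull S

open Classical in
theorem isFaceSet_image_lift {c : ℝ} {V S : Finset (Euc d)} :
    IsFaceSet evalAff (V.image (lift c)) (S.image (lift c)) ↔ IsFaceSet evalAff V S := by
  have hmem : ∀ (v : Euc d) (T : Finset (Euc d)), lift c v ∈ T.image (lift c) ↔ v ∈ T :=
    fun v T => (lift_injective c).mem_finset_image
  constructor
  · rintro ⟨hSV, a, ha⟩
    refine ⟨(Finset.image_subset_image_iff (lift_injective c)).1 hSV, a.comp (liftAff d c),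
      fun v hv => ?_⟩
    simpa [hmem] using ha (lift c v) ((hmem v V).2 hv)
  · rintro ⟨hSV, a, ha⟩
    refine ⟨Finset.image_subset_image hSV, a.comp (dropLast d).toAffineMap, fun v hv => ?_⟩
    obtain ⟨v, hv, rfl⟩ := Finset.mem_image.1 hv
    simpa [hmem] using ha v ((hmem v V).1 hv)

open Classical in
theorem card_faces_image_lift (c : ℝ) (V : Finset (Euc d)) (k : ℕ) :
    ({S ∈ (V.image (lift c)).powerset | IsFaceSet evalAff (V.image (lift c)) S ∧
      S ≠ V.image (lift c) ∧ S.card = k} : Finset _).card =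
      ({S ∈ V.powerset | IsFaceSet evalAff V S ∧ S ≠ V ∧ S.card = k} : Finset _).card := by
  rw [eq_comm, ← Finset.card_image_of_injective _ (Finset.image_injective (lift_injective c)),
    eq_comm]
  refine congrArg Finset.card (Finset.ext fun S => ?_)
  simp only [Finset.mem_filter, Finset.mem_powerset, Finset.mem_image (f := Finset.image _)]
  constructor
  · rintro ⟨hSV, hS, hne, hk⟩
    obtain ⟨T, hT, rfl⟩ := Finset.subset_image_iff.1 hSV
    exact ⟨T, ⟨Finset.coe_subset.1 hT, isFaceSet_image_lift.1 hS, fun h => hne (by rw [h]),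
      by rwa [Finset.card_image_of_injective _ (lift_injective c)] at hk⟩, rfl⟩
  · rintro ⟨T, ⟨hT, hTf, hne, hk⟩, rfl⟩
    exact ⟨Finset.image_subset_image hT, isFaceSet_image_lift.2 hTf,
      fun h => hne (Finset.image_injective (lift_injective c) h),
      by rwa [Finset.card_image_of_injective _ (lift_injective c)]⟩

end Lift

theorem isFaceSet_evalAff_empty {n : ℕ} (V : Finset (Euc n)) : IsFaceSet evalAff V ∅ :=
  ⟨Finset.empty_subset V, AffineMap.const ℝ _ 1, fun v _ => by simp⟩

theorem faceCount_self_eq_zero {n : ℕ} (V : Finset (Euc n)) :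
    faceCount (convexHull ℝ (V : Set (Euc n))) n = 0 := by
  refine (congrArg Set.ncard (Set.eq_empty_of_forall_notMem ?_)).trans (Set.ncard_empty _)
  rintro F ⟨hF, hn⟩
  obtain ⟨S, hS, hne, hSV, rfl⟩ := isProperFaceOf_convexHull_iff.1 hF
  have h1 := hS.finrank_zeroSpace_lt (hS.1.ssubset_of_ne hSV) subset_rfl
  have h2 := finrank_zeroSpace_add_setDim hne
  omega

open Classical in
theorem IsSimplicialPolytope.fBdm1_eq {d : ℕ} {V : Finset (Euc d)} (hne : V.Nonempty)
    (hV : (V : Set (Euc d)) ⊆ vertSet (convexHull ℝ V))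
    (h : IsSimplicialPolytope (convexHull ℝ (V : Set (Euc d)))) (c : ℝ) (j : ℕ) :
    fBdm1 (convexHull ℝ (V : Set (Euc d))) j =
      ({S ∈ (V.image (lift c)).powerset | IsFaceSet evalAff (V.image (lift c)) S ∧
        S ≠ V.image (lift c) ∧ S.card = j} : Finset _).card := by
  rw [card_faces_image_lift]
  cases j with
  | zero =>
    have : ({S ∈ V.powerset | IsFaceSet evalAff V S ∧ S ≠ V ∧ S.card = 0} : Finset _) = {∅} := by
      ext S
      simp only [Finset.mem_filter, Finset.mem_powerset, Finset.card_eq_zero,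
        Finset.mem_singleton]
      refine ⟨fun h => h.2.2.2, ?_⟩
      rintro rfl
      exact ⟨Finset.empty_subset V, isFaceSet_evalAff_empty V, hne.ne_empty.symm, rfl⟩
    rw [this, Finset.card_singleton]
    rfl
  | succ k => rw [fBdm1, h.faceCount_eq hV k]

theorem image_lift_subset_vertSet {d : ℕ} {V : Finset (Euc d)} (c : ℝ)
    (hV : (V : Set (Euc d)) ⊆ vertSet (convexHull ℝ V)) :
    lift c '' (V : Set (Euc d)) ⊆ vertSet (convexHull ℝ (lift c '' (V : Set (Euc d)))) := by
  rw [← image_lift_convexHull]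
  rintro _ ⟨v, hv, rfl⟩
  have hv' := hV hv
  rw [vertSet, mem_extremePoints_iff_left] at hv' ⊢
  refine ⟨mem_image_of_mem _ hv'.1, ?_⟩
  rintro _ ⟨x, hx, rfl⟩ _ ⟨y, hy, rfl⟩ hxy
  rw [← coe_liftAff, ← image_openSegment] at hxy
  obtain ⟨w, hw, hwv⟩ := hxy
  obtain rfl := lift_injective c hwv
  rw [hv'.2 x hx y hy hw]

theorem IsProperFaceOf.vertSet_subset {n : ℕ} {P F : Set (Euc n)} (h : IsProperFaceOf P F) :
    vertSet F ⊆ vertSet P :=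
  h.1.isExtreme.extremePoints_subset_extremePoints

section Cayley

open Classical in
/-- The vertices of the Cayley polytope of `convexHull ℝ V1` and `convexHull ℝ V2`. -/
def cayleyVerts {d : ℕ} (V1 V2 : Finset (Euc d)) : Finset (Euc (d + 1)) :=
  V1.image (lift 0) ∪ V2.image (lift 1)

open Classical in
theorem cayley_convexHull {d : ℕ} (V1 V2 : Finset (Euc d)) :
    cayley (convexHull ℝ (V1 : Set (Euc d))) (convexHull ℝ (V2 : Set (Euc d))) =
      convexHull ℝ (cayleyVerts V1 V2 : Set (Euc (d + 1))) := by
  rw [cayley, image_lift_convexHull, image_lift_convexHull, convexHull_convexHull_union_left,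
    convexHull_convexHull_union_right, cayleyVerts]
  push_cast
  rfl

/-- The last coordinate as an affine function. -/
def lastCoord (d : ℕ) : Euc (d + 1) →ᵃ[ℝ] ℝ := (LinearMap.proj (Fin.last d)).toAffineMap

@[simp]
theorem lastCoord_apply {d : ℕ} (x : Euc (d + 1)) : lastCoord d x = x (Fin.last d) := rfl

variable {d : ℕ} {V1 V2 : Finset (Euc d)}

open Classical in
theorem disjoint_image_lift (V1 V2 : Finset (Euc d)) :
    Disjoint (V1.image (lift 0)) (V2.image (lift 1)) := by
  rw [Finset.disjoint_left]
  intro v h1 h2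
  obtain ⟨x, -, rfl⟩ := Finset.mem_image.1 h1
  obtain ⟨y, -, hy⟩ := Finset.mem_image.1 h2
  simpa using congrFun hy (Fin.last d)

open Classical in
theorem isFaceSet_cayleyVerts_left (V1 V2 : Finset (Euc d)) :
    IsFaceSet evalAff (cayleyVerts V1 V2) (V1.image (lift 0)) := by
  refine ⟨Finset.subset_union_left, lastCoord d, fun v hv => ?_⟩
  rcases Finset.mem_union.1 hv with h | h
  · simp only [h, iff_true]
    obtain ⟨x, -, rfl⟩ := Finset.mem_image.1 h
    simp
  · simp only [Finset.disjoint_right.1 (disjoint_image_lift V1 V2) h, iff_false]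
    obtain ⟨x, -, rfl⟩ := Finset.mem_image.1 h
    simp

open Classical in
theorem isFaceSet_cayleyVerts_right (V1 V2 : Finset (Euc d)) :
    IsFaceSet evalAff (cayleyVerts V1 V2) (V2.image (lift 1)) := by
  refine ⟨Finset.subset_union_right, AffineMap.const ℝ _ 1 - lastCoord d, fun v hv => ?_⟩
  rcases Finset.mem_union.1 hv with h | h
  · simp only [Finset.disjoint_left.1 (disjoint_image_lift V1 V2) h, iff_false]
    obtain ⟨x, -, rfl⟩ := Finset.mem_image.1 h
    simp
  · simp only [h, iff_true]
    obtain ⟨x, -, rfl⟩ := Finset.mem_image.1 h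
    simp

open Classical in
theorem left_ne_cayleyVerts (hne2 : V2.Nonempty) : V1.image (lift 0) ≠ cayleyVerts V1 V2 := by
  intro h
  obtain ⟨v, hv⟩ := hne2.image (lift 1)
  exact Finset.disjoint_right.1 (disjoint_image_lift V1 V2) hv
    (h ▸ Finset.mem_union_right _ hv)

open Classical in
theorem right_ne_cayleyVerts (hne1 : V1.Nonempty) : V2.image (lift 1) ≠ cayleyVerts V1 V2 := by
  intro h
  obtain ⟨v, hv⟩ := hne1.image (lift 0)
  exact Finset.disjoint_left.1 (disjoint_image_lift V1 V2) hv
    (h ▸ Finset.mem_union_left _ hv)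

open Classical in
theorem cayleyVerts_subset_vertSet (hne1 : V1.Nonempty) (hne2 : V2.Nonempty)
    (hV1 : (V1 : Set (Euc d)) ⊆ vertSet (convexHull ℝ V1))
    (hV2 : (V2 : Set (Euc d)) ⊆ vertSet (convexHull ℝ V2)) :
    (cayleyVerts V1 V2 : Set (Euc (d + 1))) ⊆
      vertSet (convexHull ℝ (cayleyVerts V1 V2 : Set (Euc (d + 1)))) := by
  have h1 := (isProperFaceOf_convexHull_iff.2 ⟨_, isFaceSet_cayleyVerts_left V1 V2, hne1.image _,
    left_ne_cayleyVerts hne2, rfl⟩).vertSet_subset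
  have h2 := (isProperFaceOf_convexHull_iff.2 ⟨_, isFaceSet_cayleyVerts_right V1 V2, hne2.image _,
    right_ne_cayleyVerts hne1, rfl⟩).vertSet_subset
  rw [Finset.coe_image] at h1 h2
  intro v hv
  rcases Finset.mem_union.1 hv with h | h
  · exact h1 (image_lift_subset_vertSet 0 hV1 (by exact_mod_cast h))
  · exact h2 (image_lift_subset_vertSet 1 hV2 (by exact_mod_cast h))

end Cayley

section Cayley
variable {d : ℕ} {V1 V2 : Finset (Euc d)}

open Classical in
/-- The vertex sets of all faces of a polytope with vertex set `V`, including `∅` and `V`. -/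
def faceSets {n : ℕ} (V : Finset (Euc n)) : Finset (Finset (Euc n)) :=
  {S ∈ V.powerset | IsFaceSet evalAff V S}

open Classical in
theorem mem_faceSets {n : ℕ} {V S : Finset (Euc n)} : S ∈ faceSets V ↔ IsFaceSet evalAff V S := by
  rw [faceSets, Finset.mem_filter, Finset.mem_powerset, and_iff_right_iff_imp]
  exact fun h => h.1

open Classical in
theorem affineIndependent_of_mem_faceSets
    (hV : (cayleyVerts V1 V2 : Set (Euc (d + 1))) ⊆
      vertSet (convexHull ℝ (cayleyVerts V1 V2 : Set (Euc (d + 1)))))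
    (hP : ∀ F : Set (Euc (d + 1)),
      IsProperFaceOf (convexHull ℝ (cayleyVerts V1 V2 : Set (Euc (d + 1)))) F →
      F ≠ lift 0 '' convexHull ℝ (V1 : Set (Euc d)) →
      F ≠ lift 1 '' convexHull ℝ (V2 : Set (Euc d)) → IsSimplexSet F)
    {S : Finset (Euc (d + 1))} (hS : S ∈ faceSets (cayleyVerts V1 V2))
    (hSV : S ≠ cayleyVerts V1 V2) (hS1 : S ≠ V1.image (lift 0)) (hS2 : S ≠ V2.image (lift 1)) :
    AffineIndependent ℝ (fun v : {x // x ∈ S} => (v : Euc (d + 1))) := by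
  rw [mem_faceSets] at hS
  rcases S.eq_empty_or_nonempty with rfl | hne
  · exact affineIndependent_of_subsingleton ℝ _
  · refine (hP _ (isProperFaceOf_convexHull_iff.2 ⟨S, hS, hne, hSV, rfl⟩) ?_ ?_).affineIndependent
      hV hS.1
    · rw [image_lift_convexHull, ← Finset.coe_image]
      exact fun h => hS1 (convexHull_injOn_powerset hV hS.1 Finset.subset_union_left h)
    · rw [image_lift_convexHull, ← Finset.coe_image]
      exact fun h => hS2 (convexHull_injOn_powerset hV hS.1 Finset.subset_union_right h)

open Classical in
theorem mem_cayleyFaces_convexHull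
    (hV : (cayleyVerts V1 V2 : Set (Euc (d + 1))) ⊆
      vertSet (convexHull ℝ (cayleyVerts V1 V2 : Set (Euc (d + 1)))))
    {F : Set (Euc (d + 1))} :
    F ∈ cayleyFaces (convexHull ℝ (V1 : Set (Euc d))) (convexHull ℝ (V2 : Set (Euc d))) ↔
      ∃ S ∈ mixedFaces (faceSets (cayleyVerts V1 V2)) (V1.image (lift 0)) (V2.image (lift 1)),
        F = convexHull ℝ (S : Set (Euc (d + 1))) := by
  have hdisj := disjoint_image_lift V1 V2
  have hleft : ∀ S ⊆ cayleyVerts V1 V2,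
      ((S : Set (Euc (d + 1))) ∩ lift 0 '' convexHull ℝ (V1 : Set (Euc d))).Nonempty ↔
        ¬ S ⊆ V2.image (lift 1) := by
    intro S hS
    rw [Finset.not_subset]
    constructor
    · rintro ⟨_, hv, p, -, rfl⟩
      refine ⟨_, hv, fun h => ?_⟩
      obtain ⟨q, -, hq⟩ := Finset.mem_image.1 h
      simpa using congrFun hq (Fin.last d)
    · rintro ⟨v, hv, hv2⟩
      obtain ⟨p, hp, rfl⟩ := Finset.mem_image.1 ((Finset.mem_union.1 (hS hv)).resolve_right hv2)
      exact ⟨_, hv, p, subset_convexHull ℝ _ hp, rfl⟩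
  have hright : ∀ S ⊆ cayleyVerts V1 V2,
      ((S : Set (Euc (d + 1))) ∩ lift 1 '' convexHull ℝ (V2 : Set (Euc d))).Nonempty ↔
        ¬ S ⊆ V1.image (lift 0) := by
    intro S hS
    rw [Finset.not_subset]
    constructor
    · rintro ⟨_, hv, p, -, rfl⟩
      refine ⟨_, hv, fun h => ?_⟩
      obtain ⟨q, -, hq⟩ := Finset.mem_image.1 h
      simpa using congrFun hq (Fin.last d)
    · rintro ⟨v, hv, hv2⟩
      obtain ⟨p, hp, rfl⟩ := Finset.mem_image.1 ((Finset.mem_union.1 (hS hv)).resolve_left hv2)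
      exact ⟨_, hv, p, subset_convexHull ℝ _ hp, rfl⟩
  rw [cayleyFaces, Set.mem_ofPred_eq, cayley_convexHull, isProperFaceOf_convexHull_iff]
  constructor
  · rintro ⟨⟨S, hS, hne, hSV, rfl⟩, h0, h1⟩
    rw [vertSet_convexHull_of_subset hV hS.1] at h0 h1
    exact ⟨S, Finset.mem_filter.2 ⟨mem_faceSets.2 hS, hSV, (hright S hS.1).1 h1,
      (hleft S hS.1).1 h0⟩, rfl⟩
  · rintro ⟨S, hS, rfl⟩
    obtain ⟨hS, hSV, h1, h2⟩ := Finset.mem_filter.1 hS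
    rw [mem_faceSets] at hS
    rw [vertSet_convexHull_of_subset hV hS.1]
    refine ⟨⟨S, hS, ?_, hSV, rfl⟩, (hleft S hS.1).2 h2, (hright S hS.1).2 h1⟩
    rw [Finset.nonempty_iff_ne_empty]
    rintro rfl
    exact h1 (Finset.empty_subset _)

open Classical in
theorem fFm1_eq
    (hV : (cayleyVerts V1 V2 : Set (Euc (d + 1))) ⊆
      vertSet (convexHull ℝ (cayleyVerts V1 V2 : Set (Euc (d + 1)))))
    (hP : ∀ F : Set (Euc (d + 1)),
      IsProperFaceOf (convexHull ℝ (cayleyVerts V1 V2 : Set (Euc (d + 1)))) F →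
      F ≠ lift 0 '' convexHull ℝ (V1 : Set (Euc d)) →
      F ≠ lift 1 '' convexHull ℝ (V2 : Set (Euc d)) → IsSimplexSet F) (j : ℕ) :
    fFm1 (convexHull ℝ (V1 : Set (Euc d))) (convexHull ℝ (V2 : Set (Euc d))) j =
      (({S ∈ mixedFaces (faceSets (cayleyVerts V1 V2)) (V1.image (lift 0)) (V2.image (lift 1)) |
        S.card = j} : Finset _).card : ℤ) - if j = 0 then 1 else 0 := by
  set 𝓕 := mixedFaces (faceSets (cayleyVerts V1 V2)) (V1.image (lift 0)) (V2.image (lift 1))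
    with h𝓕
  have hmem : ∀ S ∈ 𝓕, S ∈ faceSets (cayleyVerts V1 V2) ∧ S.Nonempty ∧
      setDim (convexHull ℝ (S : Set (Euc (d + 1)))) + 1 = S.card := by
    intro S hS
    obtain ⟨hS, hSV, h1, h2⟩ := Finset.mem_filter.1 hS
    have hne : S.Nonempty := by
      rw [Finset.nonempty_iff_ne_empty]
      rintro rfl
      exact h1 (Finset.empty_subset _)
    exact ⟨hS, hne, (affineIndependent_of_mem_faceSets hV hP hS hSV (fun h => h1 h.subset)
      fun h => h2 h.subset).setDim_convexHull hne⟩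
  cases j with
  | zero =>
    rw [Finset.filter_false_of_mem fun S hS h => (hmem S hS).2.1.card_pos.ne' h]
    simp [fFm1]
  | succ k =>
    rw [fFm1, if_neg k.succ_ne_zero, sub_zero, ← Set.ncard_coe_finset,
      ← ((convexHull_injOn_powerset hV).mono fun S hS => ?_).ncard_image]
    · congr 2
      ext F
      simp only [Set.mem_ofPred_eq, mem_cayleyFaces_convexHull hV, Set.mem_image, Finset.mem_coe,
        Finset.mem_filter]
      constructor
      · rintro ⟨⟨S, hS, rfl⟩, hk⟩
        exact ⟨S, ⟨hS, by rw [← (hmem S hS).2.2, hk]⟩, rfl⟩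
      · rintro ⟨S, ⟨hS, hk⟩, rfl⟩
        have := (hmem S hS).2.2
        exact ⟨⟨S, hS, rfl⟩, by omega⟩
    · exact (mem_faceSets.1 (hmem S (Finset.mem_filter.1 hS).1).1).1

open Classical in
theorem finrank_zeroSpace_image_lift {V : Finset (Euc d)} (hne : V.Nonempty)
    (hdim : setDim (convexHull ℝ (V : Set (Euc d))) = d) (c : ℝ) :
    Module.finrank ℝ (zeroSpace evalAff (V.image (lift c))) = 1 := by
  have h := finrank_zeroSpace_add_setDim (hne.image (lift c))
  rw [Finset.coe_image, ← image_lift_convexHull, setDim_image_lift, hdim] at h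
  omega

open Classical in
theorem sum_faceSets_subset_eq_zero {n : ℕ} {V W F : Finset (Euc n)} (hW : W ∈ faceSets V)
    (hF : F ∈ faceSets V) (hFW : F ⊂ W) :
    ∑ S ∈ faceSets V with F ⊆ S ∧ S ⊆ W,
      (-1 : ℤ) ^ Module.finrank ℝ (zeroSpace evalAff S) = 0 := by
  rw [mem_faceSets] at hW hF
  rw [← sum_faceSet_eq_zero evalAff (hF.mono hFW.subset hW.1) hFW.ne]
  refine Finset.sum_congr (Finset.ext fun S => ?_) fun _ _ => rfl
  simp only [Finset.mem_filter, mem_faceSets, Finset.mem_powerset]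
  exact ⟨fun h => ⟨h.2.2, h.1.mono h.2.2 hW.1, h.2.1⟩, fun h => ⟨hW.trans h.2.1, h.2.2, h.1⟩⟩

open Classical in
theorem fBdm1_eq_card_faceSets {V : Finset (Euc d)} (hne : V.Nonempty)
    (hV : (V : Set (Euc d)) ⊆ vertSet (convexHull ℝ V))
    (h : IsSimplicialPolytope (convexHull ℝ (V : Set (Euc d)))) {c : ℝ}
    {W : Finset (Euc (d + 1))} (hW : V.image (lift c) ∈ faceSets W) (j : ℕ) :
    fBdm1 (convexHull ℝ (V : Set (Euc d))) j =
      ({S ∈ faceSets W | S ⊂ V.image (lift c) ∧ S.card = j} : Finset _).card := by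
  rw [h.fBdm1_eq hne hV c]
  refine congrArg _ (congrArg _ (Finset.ext fun S => ?_))
  rw [mem_faceSets] at hW
  simp only [Finset.mem_filter, mem_faceSets, Finset.mem_powerset]
  exact ⟨fun h => ⟨hW.trans h.2.1, h.1.ssubset_of_ne h.2.2.1, h.2.2.2⟩,
    fun h => ⟨h.2.1.subset, h.1.mono h.2.1.subset hW.1, h.2.1.ne, h.2.2⟩⟩

open Classical in
/-- The linear relations between the face numbers of the Cayley polytope and its two bases. -/
theorem sum_choose_mul_fFm1 (hcard1 : d + 1 ≤ V1.card) (hcard2 : d + 1 ≤ V2.card)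
    (hV1 : (V1 : Set (Euc d)) ⊆ vertSet (convexHull ℝ V1))
    (hV2 : (V2 : Set (Euc d)) ⊆ vertSet (convexHull ℝ V2))
    (hP1 : IsSimplicialPolytope (convexHull ℝ (V1 : Set (Euc d))))
    (hP2 : IsSimplicialPolytope (convexHull ℝ (V2 : Set (Euc d))))
    (hdim1 : setDim (convexHull ℝ (V1 : Set (Euc d))) = d)
    (hdim2 : setDim (convexHull ℝ (V2 : Set (Euc d))) = d)
    (hP : ∀ F : Set (Euc (d + 1)),
      IsProperFaceOf (convexHull ℝ (cayleyVerts V1 V2 : Set (Euc (d + 1)))) F →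
      F ≠ lift 0 '' convexHull ℝ (V1 : Set (Euc d)) →
      F ≠ lift 1 '' convexHull ℝ (V2 : Set (Euc d)) → IsSimplexSet F) (i : ℕ) :
    ∑ j ∈ Finset.range (d + 1 + 1), (-1 : ℤ) ^ j * (j.choose i : ℤ) *
        fFm1 (convexHull ℝ (V1 : Set (Euc d))) (convexHull ℝ (V2 : Set (Euc d))) j =
      (-1) ^ (d + 1) *
        (fFm1 (convexHull ℝ (V1 : Set (Euc d))) (convexHull ℝ (V2 : Set (Euc d))) i +
          (fBdm1 (convexHull ℝ (V1 : Set (Euc d))) i +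
            fBdm1 (convexHull ℝ (V2 : Set (Euc d))) i)) := by
  have hne1 : V1.Nonempty := Finset.card_pos.1 (by omega)
  have hne2 : V2.Nonempty := Finset.card_pos.1 (by omega)
  have hV := cayleyVerts_subset_vertSet hne1 hne2 hV1 hV2
  have hW1 := mem_faceSets.2 (isFaceSet_cayleyVerts_left V1 V2)
  have hW2 := mem_faceSets.2 (isFaceSet_cayleyVerts_right V1 V2)
  have hlt : ∀ S ∈ faceSets (cayleyVerts V1 V2), S ≠ cayleyVerts V1 V2 →
      Module.finrank ℝ (zeroSpace evalAff (cayleyVerts V1 V2)) <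
        Module.finrank ℝ (zeroSpace evalAff S) := fun S hS hSV =>
    have hS := mem_faceSets.1 hS
    hS.finrank_zeroSpace_lt (hS.1.ssubset_of_ne hSV) subset_rfl
  have hind := fun S => affineIndependent_of_mem_faceSets (S := S) hV hP
  have he : ∀ S ∈ faceSets (cayleyVerts V1 V2), S ≠ V1.image (lift 0) → S ≠ V2.image (lift 1) →
      S ≠ cayleyVerts V1 V2 → Module.finrank ℝ (zeroSpace evalAff S) + S.card = d + 1 + 1 :=
    fun S hS h1 h2 hSV => (hind S hS hSV h1 h2).finrank_zeroSpace_add_card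
  have hc1 : (V1.image (lift 0)).card = V1.card :=
    Finset.card_image_of_injective _ (lift_injective 0)
  have hc2 : (V2.image (lift 1)).card = V2.card :=
    Finset.card_image_of_injective _ (lift_injective 1)
  have hmain := sum_card_mixedFaces (Φ := faceSets (cayleyVerts V1 V2))
    (V1 := V1.image (lift 0)) (V2 := V2.image (lift 1))
    (e := fun S => Module.finrank ℝ (zeroSpace evalAff S)) (D := d + 1)
    (disjoint_image_lift V1 V2) (hne1.image _) (hne2.image _)
    (fun S hS => (mem_faceSets.1 hS).1) (mem_faceSets.2 (isFaceSet_evalAff_empty _))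
    (mem_faceSets.2 isFaceSet_self) ?_ he (fun S hS hSV => Nat.one_le_of_lt (hlt S hS hSV)) ?_ ?_
    (fun F hF hFW => sum_faceSets_subset_eq_zero hW1 hF hFW)
    (fun F hF hFW => sum_faceSets_subset_eq_zero hW2 hF hFW) i
  · simp only [fFm1_eq hV hP, fBdm1_eq_card_faceSets hne1 hV1 hP1 hW1,
      fBdm1_eq_card_faceSets hne2 hV2 hP2 hW2]
    exact hmain
  · intro S hS T hTS
    obtain ⟨hS, hSV, h1, h2⟩ := Finset.mem_filter.1 hS
    have hS1 : S ≠ V1.image (lift 0) := fun h => h1 h.subset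
    have hS2 : S ≠ V2.image (lift 1) := fun h => h2 h.subset
    have hcard := he S hS hS1 hS2 hSV
    have hlt := hlt S hS hSV
    refine ⟨mem_faceSets.2 ((mem_faceSets.1 hS).trans ((hind S hS hSV hS1 hS2).isFaceSet hTS)),
      ?_, ?_⟩
    · rintro rfl
      have := Finset.card_lt_card (hTS.ssubset_of_ne hS1.symm)
      omega
    · rintro rfl
      have := Finset.card_lt_card (hTS.ssubset_of_ne hS2.symm)
      omega
  · have h1 := hlt _ hW1 (left_ne_cayleyVerts hne2)
    rw [finrank_zeroSpace_image_lift hne1 hdim1] at h1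
    exact Nat.lt_one_iff.1 h1
  · intro F hF hFV
    rw [← sum_faceSets_subset_eq_zero (mem_faceSets.2 isFaceSet_self) hF
      ((mem_faceSets.1 hF).1.ssubset_of_ne hFV)]
    refine Finset.sum_congr (Finset.filter_congr fun S hS => ?_) fun _ _ => rfl
    exact (and_iff_left (mem_faceSets.1 hS).1).symm

end Cayley

/-- the Dehn–Sommerville-like equations for the Cayley face set 𝓕:
`h_{d+1-k}(𝓕) = h_k(𝓕) + g_k(∂P1) + g_k(∂P2)` for all `0 ≤ k ≤ d+1`. -/
theorem statement_9
    (d n1 n2 : ℕ) (hd : 2 ≤ d)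
    (P1 P2 : Set (Euc d))
    (hP1 : IsSimplicialPolytope P1) (hP2 : IsSimplicialPolytope P2)
    (hdim1 : setDim P1 = d) (hdim2 : setDim P2 = d)
    (hv1 : vertCount P1 = n1) (hv2 : vertCount P2 = n2)
    (hn1 : d + 1 ≤ n1) (hn2 : d + 1 ≤ n2)
    (hP : ∀ F : Set (Euc (d + 1)), IsProperFaceOf (cayley P1 P2) F →
      F ≠ lift 0 '' P1 → F ≠ lift 1 '' P2 → IsSimplexSet F) :
    ∀ k : ℕ, k ≤ d + 1 →
      hF P1 P2 (d + 1 - k) = hF P1 P2 k + gBd P1 k + gBd P2 k := by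
  intro k hk
  obtain ⟨V1, hV1, rfl⟩ := hP1.1.exists_finset
  obtain ⟨V2, hV2, rfl⟩ := hP2.1.exists_finset
  rw [vertCount, ← hV1, Set.ncard_coe_finset] at hv1
  rw [vertCount, ← hV2, Set.ncard_coe_finset] at hv2
  rw [cayley_convexHull] at hP
  have hsymm := hVector_symm (d + 1)
    (fFm1 (convexHull ℝ (V1 : Set (Euc d))) (convexHull ℝ (V2 : Set (Euc d))))
    (fun i => fBdm1 (convexHull ℝ (V1 : Set (Euc d))) i +
      fBdm1 (convexHull ℝ (V2 : Set (Euc d))) i)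
    (fun i _ => sum_choose_mul_fFm1 (hv1.symm ▸ hn1) (hv2.symm ▸ hn2) hV1.subset hV2.subset
      hP1 hP2 hdim1 hdim2 hP i) k hk
  have hzero : ∀ V : Finset (Euc d), fBdm1 (convexHull ℝ (V : Set (Euc d))) (d + 1) = 0 :=
    fun V => by rw [fBdm1, faceCount_self_eq_zero, Nat.cast_zero]
  rw [gBd_eq _ (hzero V1) hk, gBd_eq _ (hzero V2) hk, hF, hF, hsymm, ← Finset.sum_add_distrib,
    ← Finset.sum_add_distrib]
  exact Finset.sum_congr rfl fun i _ => by ring
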